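/- Assume ζ_p ∈ K, let t' = p·e_K/(p−1), and let N_{t'} be the subgroup of K^× generated by K^{×p}, π and all the elements η_{(x,y)} = 1 + c_y π^x with x ∈ I, 1 ≤ y ≤ f_K. Then any finite abelian extension L_{t'}/K whose norm group N_{L_{t'}/K}(L_{t'}^×) equals N_{t'} is cyclic of degree p with unique upper ramification jump equal to t'. -/

import Mathlib

noncomputable section

open scoped Classical

namespace PaperRam

/-- An additive `ℤ ∪ {∞}`-valued valuation on a field is *normalized* if it is
surjective onto `ℤ`. -/
def IsNormalized {F : Type*} [Field F] (v : AddValuation F (WithTop ℤ)) : Prop :=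
  ∀ n : ℤ, ∃ x : F, v x = (n : WithTop ℤ)

/-- The normalized valuation `vF` of `F` extends the normalized valuation `vK` of `K`
with ramification index `e`, i.e. `vF(x) = e · vK(x)` for all `x ∈ K`. -/
def Extends {K F : Type*} [Field K] [Field F] [Algebra K F]
    (vK : AddValuation K (WithTop ℤ)) (vF : AddValuation F (WithTop ℤ)) (e : ℕ) : Prop :=
  0 < e ∧ ∀ x : K, vF (algebraMap K F x) = e • vK x

/-- `v` is the normalized valuation of the `p`-adic field `K`, with (absolute)
ramification index `eK` over `ℚ_p`. -/
def IsPadicValuation (p : ℕ) [Fact p.Prime] {K : Type*} [Field K] [Algebra ℚ_[p] K]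
    (v : AddValuation K (WithTop ℤ)) (eK : ℕ) : Prop :=
  IsNormalized v ∧ 0 < eK ∧
    ∀ x : ℚ_[p], x ≠ 0 → v (algebraMap ℚ_[p] K x) = ((eK * x.valuation : ℤ) : WithTop ℤ)

/-- The valuation `v` of `F` is invariant under all `K`-algebra automorphisms of `F`. -/
def GalInvariant (K : Type*) {F : Type*} [Field K] [Field F] [Algebra K F]
    (v : AddValuation F (WithTop ℤ)) : Prop :=
  ∀ (σ : F ≃ₐ[K] F) (x : F), v (σ x) = v x

variable {K F : Type*} [Field K] [Field F] [Algebra K F]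

/-- The lower-numbering ramification subgroup `G_i` of `Gal(F/K)`:
`σ ∈ G_i ↔ v(σ x − x) ≥ i + 1` for all `x` in the valuation ring of `F`. -/
def lowerRG (v : AddValuation F (WithTop ℤ)) (hv : GalInvariant K v) (i : ℤ) :
    Subgroup (F ≃ₐ[K] F) where
  carrier := {σ | ∀ x : F, 0 ≤ v x → ((i + 1 : ℤ) : WithTop ℤ) ≤ v (σ x - x)}
  one_mem' := by
    intro x _
    simp
  mul_mem' := by
    intro a b ha hb x hx
    have h1 : ((i + 1 : ℤ) : WithTop ℤ) ≤ v (a (b x) - b x) :=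
      ha (b x) (by rw [hv b x]; exact hx)
    have h2 := hb x hx
    have hrw : (a * b) x - x = (a (b x) - b x) + (b x - x) := by
      rw [AlgEquiv.mul_apply]; ring
    rw [hrw]
    exact v.map_le_add h1 h2
  inv_mem' := by
    intro a ha x hx
    have hda : a (a⁻¹ x - x) = x - a x := by
      rw [map_sub]
      congr 1
      exact a.apply_symm_apply x
    have : v (a⁻¹ x - x) = v (a x - x) := by
      rw [← hv a (a⁻¹ x - x), hda, v.map_sub_swap]
    rw [this]
    exact ha x hx

/-- The Herbrand function `φ_{F/K}` evaluated at integers. -/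
def herbrandPhi (v : AddValuation F (WithTop ℤ)) (hv : GalInvariant K v) (n : ℤ) : ℚ :=
  if n ≤ 0 then (n : ℚ)
  else (∑ i ∈ Finset.Icc (1 : ℤ) n, (Nat.card (lowerRG v hv i) : ℚ)) /
    (Nat.card (lowerRG v hv 0) : ℚ)

/-- The upper-numbering ramification subgroup `G^u = G_{ψ(u)}` of `Gal(F/K)`. -/
def upperRG (v : AddValuation F (WithTop ℤ)) (hv : GalInvariant K v) (u : ℤ) :
    Subgroup (F ≃ₐ[K] F) :=
  lowerRG v hv (sInf {n : ℤ | (u : ℚ) ≤ herbrandPhi v hv n})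

/-- `t` is an upper ramification jump of `F/K`: `G^u ≠ G^t` for every `u > t`. -/
def IsUpperJump (v : AddValuation F (WithTop ℤ)) (hv : GalInvariant K v) (t : ℤ) : Prop :=
  ∀ u : ℤ, t < u → upperRG v hv u ≠ upperRG v hv t

/-- A group is elementary abelian of exponent `p` if it is isomorphic to `(ℤ/pℤ)^k`
for some `k`. -/
def IsElemAbelian (p : ℕ) (G : Type*) [Group G] : Prop :=
  ∃ k : ℕ, Nonempty (G ≃* (Fin k → Multiplicative (ZMod p)))

/-- The norm group `N_{L/K}(L^×)`, as a subgroup of `K^×`. -/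
def normGroup (K L : Type*) [Field K] [Field L] [Algebra K L] : Subgroup Kˣ :=
  (Units.map (Algebra.norm K : L →* K)).range

/-- The residues of `c 0, …, c (f-1)` lie in the valuation ring and form a basis of
the residue field of `v` over `𝔽_p`. -/
def IsResidueBasis (p : ℕ) {K : Type*} [Field K] (v : AddValuation K (WithTop ℤ))
    {f : ℕ} (c : Fin f → K) : Prop :=
  (∀ y, 0 ≤ v (c y)) ∧
  (∀ a : Fin f → ℤ, (1 : WithTop ℤ) ≤ v (∑ y, (a y : K) * c y) → ∀ y, (p : ℤ) ∣ a y) ∧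
  (∀ x : K, 0 ≤ v x → ∃ a : Fin f → ℤ, (1 : WithTop ℤ) ≤ v (x - ∑ y, (a y : K) * c y))

/-- `v_L(𝒟_{L/K})`: the valuation of the different of `L/K`, defined through the
inverse different `{x ∈ L ∣ Tr_{L/K}(x·𝒪_L) ⊆ 𝒪_K} = 𝔪_L^{-d}`. -/
def differentVal (K : Type*) {L : Type*} [Field K] [Field L] [Algebra K L]
    (vK : AddValuation K (WithTop ℤ)) (vL : AddValuation L (WithTop ℤ)) : ℤ :=
  sSup {m : ℤ | ∃ x : L, vL x = ((-m : ℤ) : WithTop ℤ) ∧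
    ∀ y : L, 0 ≤ vL y → 0 ≤ vK (Algebra.trace K L (x * y))}

/-- The maximal elementary abelian `p`-extension `𝒞_K(p)` of `K` inside `Ω`: the
compositum of all cyclic (equivalently, normal) extensions of `K` of degree `p`. -/
def maxElemAbelian (p : ℕ) (K Ω : Type*) [Field K] [Field Ω] [Algebra K Ω] :
    IntermediateField K Ω :=
  ⨆ L ∈ {L : IntermediateField K Ω | Module.finrank K L = p ∧ Normal K L}, L

/-- The subgroup `U_K^{i+1} = 1 + 𝔪_K^{i+1}` of principal units of `K^×`
(the index is shifted by one so that `principalUnits v 0 = U_K^1`). -/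
def principalUnits {K : Type*} [Field K] (v : AddValuation K (WithTop ℤ)) (i : ℕ) :
    Subgroup Kˣ where
  carrier := {x : Kˣ | (((i : ℤ) + 1 : ℤ) : WithTop ℤ) ≤ v ((x : K) - 1)}
  one_mem' := by simp
  mul_mem' := by
    intro a b ha hb
    have hpos : (0 : WithTop ℤ) < (((i : ℤ) + 1 : ℤ) : WithTop ℤ) := by
      rw [show (0 : WithTop ℤ) = ((0 : ℤ) : WithTop ℤ) from rfl]
      exact WithTop.coe_lt_coe.mpr (by omega)
    have hva : v (a : K) = 0 := by
      have h1 : v ((1 : K)) < v ((a : K) - 1) := by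
        rw [v.map_one]; exact lt_of_lt_of_le hpos ha
      have h2 := v.map_add_eq_of_lt_right h1
      rw [sub_add_cancel] at h2
      rw [h2, v.map_one]
    have key : ((a * b : Kˣ) : K) - 1 = (a : K) * ((b : K) - 1) + ((a : K) - 1) := by
      push_cast; ring
    show (((i : ℤ) + 1 : ℤ) : WithTop ℤ) ≤ v (((a * b : Kˣ) : K) - 1)
    rw [key]
    refine v.map_le_add ?_ ha
    rw [v.map_mul, hva, zero_add]
    exact hb
  inv_mem' := by
    intro a ha
    have hpos : (0 : WithTop ℤ) < (((i : ℤ) + 1 : ℤ) : WithTop ℤ) := by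
      rw [show (0 : WithTop ℤ) = ((0 : ℤ) : WithTop ℤ) from rfl]
      exact WithTop.coe_lt_coe.mpr (by omega)
    have hva : v (a : K) = 0 := by
      have h1 : v ((1 : K)) < v ((a : K) - 1) := by
        rw [v.map_one]; exact lt_of_lt_of_le hpos ha
      have h2 := v.map_add_eq_of_lt_right h1
      rw [sub_add_cancel] at h2
      rw [h2, v.map_one]
    have key : ((a⁻¹ : Kˣ) : K) - 1 = ((a : K))⁻¹ * (1 - (a : K)) := by
      rw [mul_sub, mul_one, inv_mul_cancel₀ (Units.ne_zero a)]
      push_cast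
      ring
    show (((i : ℤ) + 1 : ℤ) : WithTop ℤ) ≤ v (((a⁻¹ : Kˣ) : K) - 1)
    rw [key, v.map_mul, v.map_inv, hva, v.map_sub_swap]
    simpa using ha

section Levels

variable {E : Type*} [Field E] {v : AddValuation E (WithTop ℤ)}

/-- `x` has valuation at least `n`. -/
def LevelGE (v : AddValuation E (WithTop ℤ)) (n : ℤ) (x : E) : Prop := (n : WithTop ℤ) ≤ v x

namespace LevelGE

lemma mono {m n : ℤ} {x : E} (h : LevelGE v n x) (hmn : m ≤ n) : LevelGE v m x :=
  le_trans (WithTop.coe_le_coe.mpr hmn) h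

lemma zero (n : ℤ) : LevelGE v n 0 := by simp [LevelGE]

lemma one : LevelGE v 0 1 := by simp [LevelGE]

lemma add {n : ℤ} {x y : E} (hx : LevelGE v n x) (hy : LevelGE v n y) : LevelGE v n (x + y) :=
  v.map_le_add hx hy

lemma sub {n : ℤ} {x y : E} (hx : LevelGE v n x) (hy : LevelGE v n y) : LevelGE v n (x - y) :=
  v.map_le_sub hx hy

lemma neg {n : ℤ} {x : E} (hx : LevelGE v n x) : LevelGE v n (-x) := by
  simpa [LevelGE] using hx

lemma sub_comm {n : ℤ} {x y : E} (hx : LevelGE v n (x - y)) : LevelGE v n (y - x) := by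
  simpa using hx.neg

lemma trans {n : ℤ} {x y z : E} (hx : LevelGE v n (x - y)) (hy : LevelGE v n (y - z)) :
    LevelGE v n (x - z) := by
  simpa using hx.add hy

lemma mul {m n : ℤ} {x y : E} (hx : LevelGE v m x) (hy : LevelGE v n y) :
    LevelGE v (m + n) (x * y) := by
  unfold LevelGE at *
  rw [v.map_mul, WithTop.coe_add]
  exact add_le_add hx hy

lemma mul' {m n k : ℤ} {x y : E} (hx : LevelGE v m x) (hy : LevelGE v n y) (h : k ≤ m + n) :
    LevelGE v k (x * y) := (hx.mul hy).mono h

lemma pow {m : ℤ} {x : E} (hx : LevelGE v m x) (k : ℕ) : LevelGE v (k * m) (x ^ k) := by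
  induction k with
  | zero => simpa using one
  | succ k ih =>
    rw [pow_succ]
    exact ih.mul' hx (by push_cast; linarith)

lemma pow0 {x : E} (hx : LevelGE v 0 x) (k : ℕ) : LevelGE v 0 (x ^ k) := by
  simpa using hx.pow k

lemma sum {ι : Type*} {s : Finset ι} {f : ι → E} {n : ℤ} (h : ∀ i ∈ s, LevelGE v n (f i)) :
    LevelGE v n (∑ i ∈ s, f i) := v.map_le_sum h

lemma prod {ι : Type*} {s : Finset ι} {f : ι → E} {n : ℤ} (h : ∀ i ∈ s, LevelGE v n (f i)) :
    LevelGE v (s.card * n) (∏ i ∈ s, f i) := by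
  induction s using Finset.induction_on with
  | empty => simpa using one
  | insert a s ha ih =>
    rw [Finset.prod_insert ha, Finset.card_insert_of_notMem ha]
    refine (h a (by simp)).mul' (ih fun i hi => h i (by simp [hi])) ?_
    push_cast; linarith

lemma natCast (n : ℕ) : LevelGE v 0 (n : E) := by
  induction n with
  | zero => simpa using zero 0
  | succ n ih => push_cast; exact ih.add one

lemma intCast (n : ℤ) : LevelGE v 0 (n : E) := by
  obtain ⟨k, rfl | rfl⟩ := n.eq_nat_or_neg
  · simpa using natCast k
  · simpa using (natCast k).neg

lemma aeval {y : E} (hy : LevelGE v 0 y) (f : Polynomial ℤ) :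
    LevelGE v 0 (Polynomial.aeval y f) := by
  rw [Polynomial.aeval_eq_sum_range]
  refine sum fun i _ => ?_
  rw [zsmul_eq_mul]
  exact (intCast _).mul' (hy.pow0 i) (by simp)

end LevelGE

lemma levelGE_iff {n m : ℤ} {x : E} (h : v x = (m : WithTop ℤ)) : LevelGE v n x ↔ n ≤ m := by
  unfold LevelGE
  rw [h, WithTop.coe_le_coe]

lemma levelGE_of_eq {m : ℤ} {x : E} (h : v x = (m : WithTop ℤ)) : LevelGE v m x :=
  (levelGE_iff h).2 le_rfl

lemma val_eq_iff {m : ℤ} {x : E} :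
    v x = (m : WithTop ℤ) ↔ LevelGE v m x ∧ ¬ LevelGE v (m + 1) x := by
  constructor
  · intro h
    rw [levelGE_iff h, levelGE_iff h]
    omega
  · rintro ⟨h1, h2⟩
    unfold LevelGE at *
    cases hx : v x with
    | top => simp [hx] at h2
    | coe a =>
      rw [hx] at h1 h2
      rw [WithTop.coe_le_coe] at h1 h2
      rw [WithTop.coe_inj]
      omega

lemma exists_val {x : E} (hx : x ≠ 0) : ∃ n : ℤ, v x = (n : WithTop ℤ) := by
  obtain ⟨n, hn⟩ := WithTop.ne_top_iff_exists.1 ((v.ne_top_iff).2 hx)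
  exact ⟨n, hn.symm⟩

lemma ne_zero_of_val {x : E} {n : ℤ} (h : v x = (n : WithTop ℤ)) : x ≠ 0 := by
  rintro rfl
  simp at h

lemma ne_zero_of_not_levelGE {x : E} {n : ℤ} (h : ¬ LevelGE v n x) : x ≠ 0 := by
  rintro rfl
  exact h (LevelGE.zero n)

lemma eq_zero_of_levelGE {x : E} (h : ∀ n : ℤ, LevelGE v n x) : x = 0 := by
  by_contra hx
  obtain ⟨n, hn⟩ := exists_val (v := v) hx
  have := (levelGE_iff hn).1 (h (n + 1))
  omega

lemma val_mul {x y : E} {m n : ℤ} (hx : v x = (m : WithTop ℤ)) (hy : v y = (n : WithTop ℤ)) :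
    v (x * y) = ((m + n : ℤ) : WithTop ℤ) := by
  rw [v.map_mul, hx, hy, WithTop.coe_add]

lemma val_one : v (1 : E) = ((0 : ℤ) : WithTop ℤ) := by simp

lemma val_pow {x : E} {m : ℤ} (hx : v x = (m : WithTop ℤ)) (k : ℕ) :
    v (x ^ k) = ((k * m : ℤ) : WithTop ℤ) := by
  induction k with
  | zero => simp
  | succ k ih =>
    rw [pow_succ, val_mul ih hx]
    congr 1
    push_cast; ring

lemma val_inv {x : E} {m : ℤ} (hx : v x = (m : WithTop ℤ)) :
    v x⁻¹ = ((-m : ℤ) : WithTop ℤ) := by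
  obtain ⟨n, hn⟩ := exists_val (v := v) (inv_ne_zero (ne_zero_of_val hx))
  have h := val_mul hx hn
  rw [mul_inv_cancel₀ (ne_zero_of_val hx), val_one, WithTop.coe_inj] at h
  rw [hn, WithTop.coe_inj]
  omega

lemma val_div {x y : E} {m n : ℤ} (hx : v x = (m : WithTop ℤ)) (hy : v y = (n : WithTop ℤ)) :
    v (x / y) = ((m - n : ℤ) : WithTop ℤ) := by
  rw [div_eq_mul_inv, val_mul hx (val_inv hy), sub_eq_add_neg]

lemma val_zpow {x : E} {m : ℤ} (hx : v x = (m : WithTop ℤ)) (k : ℤ) :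
    v (x ^ k) = ((k * m : ℤ) : WithTop ℤ) := by
  obtain ⟨n, rfl | rfl⟩ := k.eq_nat_or_neg
  · simpa using val_pow hx n
  · rw [zpow_neg, zpow_natCast, val_inv (val_pow hx n)]
    congr 1
    ring

lemma val_eq_of_sub {x y : E} {n : ℤ} (hx : v x = (n : WithTop ℤ))
    (h : LevelGE v (n + 1) (y - x)) : v y = (n : WithTop ℤ) := by
  rw [val_eq_iff] at *
  refine ⟨by simpa using hx.1.add (h.mono (by omega)), fun h' => hx.2 ?_⟩
  simpa using h'.sub h

lemma LevelGE.inv_mul {x y : E} {m n k : ℤ} (hx : v x = (m : WithTop ℤ)) (hy : LevelGE v n y)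
    (h : k ≤ n - m) : LevelGE v k (y / x) := by
  rw [div_eq_mul_inv]
  exact hy.mul' (levelGE_of_eq (val_inv hx)) (by omega)

/-- `x` is a unit congruent to `1` modulo valuation `≥ 1`. -/
lemma val_of_sub_one {x : E} {n : ℤ} (hn : 1 ≤ n) (h : LevelGE v n (x - 1)) :
    v x = ((0 : ℤ) : WithTop ℤ) :=
  val_eq_of_sub val_one (h.mono (by omega))

lemma LevelGE.mul_sub_one {x y : E} {n : ℤ} (hn : 0 ≤ n) (hx : LevelGE v n (x - 1))
    (hy : LevelGE v n (y - 1)) : LevelGE v n (x * y - 1) := by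
  have : x * y - 1 = (x - 1) * (y - 1) + (x - 1) + (y - 1) := by ring
  rw [this]
  exact ((hx.mul' hy (by omega)).add hx).add hy

lemma LevelGE.inv_sub_one {x : E} {n : ℤ} (hn : 1 ≤ n) (hx : LevelGE v n (x - 1)) :
    LevelGE v n (x⁻¹ - 1) := by
  have h0 := val_of_sub_one hn hx
  have : x⁻¹ - 1 = (1 - x) / x := by
    field_simp [ne_zero_of_val h0]
  rw [this]
  exact LevelGE.inv_mul h0 hx.sub_comm (by omega)

lemma LevelGE.div_sub_one {x y : E} {n : ℤ} (hn : 1 ≤ n) (hx : LevelGE v n (x - 1))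
    (hy : LevelGE v n (y - 1)) : LevelGE v n (x / y - 1) := by
  rw [div_eq_mul_inv]
  exact hx.mul_sub_one (by omega) (hy.inv_sub_one hn)

lemma LevelGE.div_sub_one' {x y : E} {n : ℤ} (hy : v y = ((0 : ℤ) : WithTop ℤ))
    (h : LevelGE v n (x - y)) : LevelGE v n (x / y - 1) := by
  have : x / y - 1 = (x - y) / y := by
    field_simp [ne_zero_of_val hy]
  rw [this]
  exact LevelGE.inv_mul hy h (by omega)

lemma LevelGE.sub_of_div {x y : E} {n : ℤ} (hy : v y = ((0 : ℤ) : WithTop ℤ))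
    (h : LevelGE v n (x / y - 1)) : LevelGE v n (x - y) := by
  have : x - y = (x / y - 1) * y := by
    field_simp [ne_zero_of_val hy]
  rw [this]
  exact h.mul' (levelGE_of_eq hy) (by omega)

/-- A sum of elements with pairwise distinct finite valuations has minimal valuation. -/
lemma LevelGE.of_sum_distinct {ι : Type*} {s : Finset ι} {f : ι → E} {n : ℤ}
    (hd : ∀ i ∈ s, ∀ j ∈ s, i ≠ j → f i ≠ 0 → v (f i) ≠ v (f j))
    (h : LevelGE v n (∑ i ∈ s, f i)) : ∀ i ∈ s, LevelGE v n (f i) := by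
  intro i hi
  obtain ⟨j, hj, hmin⟩ := s.exists_min_image (fun i => v (f i)) ⟨i, hi⟩
  refine le_trans ?_ (hmin i hi)
  by_cases h0 : f j = 0
  · simp [h0]
  · have hlt : v (f j) < v (∑ i ∈ s.erase j, f i) := by
      refine v.map_lt_sum' (lt_of_le_of_ne le_top ((v.ne_top_iff).2 h0)) fun k hk => ?_
      exact lt_of_le_of_ne (hmin k (Finset.mem_of_mem_erase hk))
        (hd j hj k (Finset.mem_of_mem_erase hk) (Finset.ne_of_mem_erase hk).symm h0)
    have := v.map_add_eq_of_lt_left hlt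
    rw [Finset.add_sum_erase _ _ hj] at this
    rw [← this]
    exact h

/-- The residue congruence on the valuation ring. -/
def residueSetoid (v : AddValuation E (WithTop ℤ)) : Setoid {x : E // LevelGE v 0 x} where
  r x y := LevelGE v 1 (x.1 - y.1)
  iseqv :=
    { refl := fun x => by simpa using LevelGE.zero 1
      symm := fun h => h.sub_comm
      trans := fun h h' => h.trans h' }

/-- The residue classes of the valuation ring. -/
abbrev Residues (v : AddValuation E (WithTop ℤ)) := Quotient (residueSetoid v)

/-- A map on the valuation ring compatible with residues which is surjective on residues is
injective on residues. -/
lemma residue_injective_of_surjective [Finite (Residues v)] (g : E → E)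
    (h0 : ∀ x, LevelGE v 0 x → LevelGE v 0 (g x))
    (hg : ∀ x y, LevelGE v 0 x → LevelGE v 0 y → LevelGE v 1 (x - y) → LevelGE v 1 (g x - g y))
    (hs : ∀ r, LevelGE v 0 r → ∃ x, LevelGE v 0 x ∧ LevelGE v 1 (g x - r))
    (x y : E) (hx : LevelGE v 0 x) (hy : LevelGE v 0 y) (hxy : LevelGE v 1 (g x - g y)) :
    LevelGE v 1 (x - y) := by
  let G : Residues v → Residues v :=
    Quotient.map (fun x => ⟨g x.1, h0 x.1 x.2⟩) (fun a b hab => hg a.1 b.1 a.2 b.2 hab)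
  have hG : Function.Surjective G := by
    intro r
    induction r using Quotient.inductionOn with
    | h r =>
      obtain ⟨x, hx, hxr⟩ := hs r.1 r.2
      exact ⟨Quotient.mk _ ⟨x, hx⟩, Quotient.sound hxr⟩
  have := (Finite.injective_iff_surjective.2 hG)
    (a₁ := Quotient.mk _ ⟨x, hx⟩) (a₂ := Quotient.mk _ ⟨y, hy⟩) (Quotient.sound hxy)
  exact Quotient.exact this

lemma residue_surjective_of_injective [Finite (Residues v)] (g : E → E)
    (h0 : ∀ x, LevelGE v 0 x → LevelGE v 0 (g x))
    (hg : ∀ x y, LevelGE v 0 x → LevelGE v 0 y → LevelGE v 1 (x - y) → LevelGE v 1 (g x - g y))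
    (hi : ∀ x y, LevelGE v 0 x → LevelGE v 0 y → LevelGE v 1 (g x - g y) → LevelGE v 1 (x - y))
    (r : E) (hr : LevelGE v 0 r) : ∃ x, LevelGE v 0 x ∧ LevelGE v 1 (g x - r) := by
  let G : Residues v → Residues v :=
    Quotient.map (fun x => ⟨g x.1, h0 x.1 x.2⟩) (fun a b hab => hg a.1 b.1 a.2 b.2 hab)
  have hG : Function.Injective G := by
    intro a b
    induction a using Quotient.inductionOn with
    | h a =>
      induction b using Quotient.inductionOn with
      | h b =>
        intro hab
        exact Quotient.sound (hi a.1 b.1 a.2 b.2 (Quotient.exact hab))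
  obtain ⟨x, hx⟩ := (Finite.injective_iff_surjective.1 hG) (Quotient.mk _ ⟨r, hr⟩)
  induction x using Quotient.inductionOn with
  | h x => exact ⟨x.1, x.2, Quotient.exact hx⟩

end Levels

section Topology

variable {p : ℕ} [Fact p.Prime] {E : Type*} [Field E] [Algebra ℚ_[p] E]
  {v : AddValuation E (WithTop ℤ)} {e : ℕ}

lemma IsPadicValuation.val_natCast_self (h : IsPadicValuation p v e) :
    v (p : E) = ((e : ℤ) : WithTop ℤ) := by
  have hp : (p : ℚ_[p]) ≠ 0 := by exact_mod_cast (Fact.out : p.Prime).ne_zero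
  have := h.2.2 (p : ℚ_[p]) hp
  rw [map_natCast, Padic.valuation_p] at this
  simpa using this

/-- The absolute value attached to a `p`-adic valuation, extending the one of `ℚ_p`. -/
def padicAbs (h : IsPadicValuation p v e) : AbsoluteValue E ℝ where
  toFun x := if x = 0 then 0 else (p : ℝ) ^ (-(((v x).untopD 0 : ℤ) : ℝ) / e)
  map_mul' x y := by
    by_cases hx : x = 0
    · simp [hx]
    by_cases hy : y = 0
    · simp [hy]
    obtain ⟨m, hm⟩ := exists_val (v := v) hx
    obtain ⟨n, hn⟩ := exists_val (v := v) hy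
    have hp : (0 : ℝ) < p := by exact_mod_cast (Fact.out : p.Prime).pos
    simp only [mul_eq_zero, hx, hy, or_self, if_false]
    rw [hm, hn, val_mul hm hn, ← Real.rpow_add hp]
    simp only [WithTop.untopD_coe]
    congr 1
    push_cast
    ring
  nonneg' x := by
    split_ifs
    · exact le_rfl
    · positivity
  eq_zero' x := by
    have hp : (0 : ℝ) < p := by exact_mod_cast (Fact.out : p.Prime).pos
    split_ifs with hx
    · simp [hx]
    · simp [hx, (Real.rpow_pos_of_pos hp _).ne']
  add_le' x y := by
    have hp : (1 : ℝ) < p := by exact_mod_cast (Fact.out : p.Prime).one_lt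
    have he : (0 : ℝ) < e := by exact_mod_cast h.2.1
    by_cases hx : x = 0
    · simp [hx]
    by_cases hy : y = 0
    · simp [hy]
    by_cases hxy : x + y = 0
    · simp only [hxy, hx, hy, if_true, if_false]
      positivity
    obtain ⟨m, hm⟩ := exists_val (v := v) hx
    obtain ⟨n, hn⟩ := exists_val (v := v) hy
    obtain ⟨k, hk⟩ := exists_val (v := v) hxy
    simp only [hxy, hx, hy, if_false, hm, hn, hk, WithTop.untopD_coe]
    have hmin := v.map_add x y
    rw [hm, hn, hk, min_le_iff, WithTop.coe_le_coe, WithTop.coe_le_coe] at hmin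
    have key : ∀ a : ℤ, a ≤ k → (p : ℝ) ^ (-(k : ℝ) / e) ≤ (p : ℝ) ^ (-(a : ℝ) / e) := by
      intro a ha
      apply Real.rpow_le_rpow_of_exponent_le hp.le
      have : (a : ℝ) ≤ k := by exact_mod_cast ha
      gcongr
    have h1 : (0 : ℝ) < (p : ℝ) ^ (-(m : ℝ) / e) := by positivity
    have h2 : (0 : ℝ) < (p : ℝ) ^ (-(n : ℝ) / e) := by positivity
    rcases hmin with hmin | hmin
    · linarith [key _ hmin]
    · linarith [key _ hmin]

lemma padicAbs_lt_one_iff (h : IsPadicValuation p v e) (x : E) (n : ℤ) :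
    padicAbs h x < (p : ℝ) ^ (-((n : ℝ) - 1) / e) ↔ LevelGE v n x := by
  have hp : (1 : ℝ) < p := by exact_mod_cast (Fact.out : p.Prime).one_lt
  have he : (0 : ℝ) < e := by exact_mod_cast h.2.1
  by_cases hx : x = 0
  · subst hx
    simp only [map_zero, LevelGE.zero, iff_true]
    positivity
  · obtain ⟨m, hm⟩ := exists_val (v := v) hx
    show (if x = 0 then 0 else (p : ℝ) ^ (-(((v x).untopD 0 : ℤ) : ℝ) / e)) < _ ↔ _
    rw [levelGE_iff hm, if_neg hx, hm, WithTop.untopD_coe, Real.rpow_lt_rpow_left_iff hp,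
      div_lt_div_iff_of_pos_right he, neg_lt_neg_iff, ← Int.cast_one, ← Int.cast_sub,
      Int.cast_lt]
    omega

lemma padicAbs_algebraMap (h : IsPadicValuation p v e) (x : ℚ_[p]) :
    padicAbs h (algebraMap ℚ_[p] E x) = ‖x‖ := by
  by_cases hx : x = 0
  · simp [hx]
  have hx' : algebraMap ℚ_[p] E x ≠ 0 := by simpa using hx
  have he : (e : ℝ) ≠ 0 := by exact_mod_cast h.2.1.ne'
  show (if algebraMap ℚ_[p] E x = 0 then 0 else _) = _
  rw [if_neg hx', h.2.2 x hx, WithTop.untopD_coe, Padic.norm_eq_zpow_neg_valuation hx,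
    ← Real.rpow_intCast]
  congr 1
  push_cast
  field_simp

variable [FiniteDimensional ℚ_[p] E]

lemma IsPadicValuation.finite_residues (h : IsPadicValuation p v e) : Finite (Residues v) := by
  let _ : NormedField E := (padicAbs h).toNormedField
  have hnorm : ∀ x : E, ‖x‖ = padicAbs h x := fun _ => rfl
  let _ : NormedAlgebra ℚ_[p] E :=
    { ‹Algebra ℚ_[p] E› with
      norm_smul_le := fun r x => by
        rw [Algebra.smul_def, norm_mul]
        exact (congrArg (· * ‖x‖) (padicAbs_algebraMap h r)).le }
  have : ProperSpace E := FiniteDimensional.proper ℚ_[p] E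
  obtain ⟨t, -, htf, ht⟩ := (isCompact_closedBall (0 : E) 1).finite_cover_balls one_pos
  have hball : ∀ x y : E, x ∈ Metric.ball y 1 → LevelGE v 1 (x - y) := by
    intro x y hx
    rw [← padicAbs_lt_one_iff h]
    rw [mem_ball_iff_norm] at hx
    simpa [hnorm] using hx
  have hO : ∀ x : E, LevelGE v 0 x → x ∈ Metric.closedBall (0 : E) 1 := by
    intro x hx
    by_contra hx1
    have hx0 : x ≠ 0 := by
      rintro rfl
      simp at hx1
    obtain ⟨m, hm⟩ := exists_val (v := v) hx0
    rw [mem_closedBall_zero_iff, not_le] at hx1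
    have h1 : ‖x⁻¹‖ < 1 := by
      rw [norm_inv]
      exact inv_lt_one_of_one_lt₀ hx1
    have h2 : LevelGE v 1 x⁻¹ := by
      rw [← padicAbs_lt_one_iff h]
      simpa [hnorm] using h1
    rw [levelGE_iff (val_inv hm)] at h2
    rw [levelGE_iff hm] at hx
    omega
  choose! c hc using fun x (hx : LevelGE v 0 x) => Set.mem_iUnion₂.1 (ht (hO x hx))
  have : Finite t := htf
  let f : Residues v → t := fun r => ⟨c r.out.1, (hc r.out.1 r.out.2).1⟩
  refine Finite.of_injective f fun r s hrs => ?_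
  have h1 := hball _ _ (hc r.out.1 r.out.2).2
  have h2 := hball _ _ (hc s.out.1 s.out.2).2
  rw [← Quotient.out_eq r, ← Quotient.out_eq s]
  apply Quotient.sound
  have h3 : c r.out.1 = c s.out.1 := congrArg Subtype.val hrs
  rw [h3] at h1
  exact h1.trans h2.sub_comm

lemma IsPadicValuation.exists_pow_eq (h : IsPadicValuation p v e) :
    ∃ m : ℕ, ∀ x : E, LevelGE v m (x - 1) → ∃ w : E, w ^ p = x := by
  let _ : NormedField E := (padicAbs h).toNormedField
  have hnorm : ∀ x : E, ‖x‖ = padicAbs h x := fun _ => rfl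
  have hp1 : (1 : ℝ) < p := by exact_mod_cast (Fact.out : p.Prime).one_lt
  have hp0 : (p : E) ≠ 0 := ne_zero_of_val h.val_natCast_self
  have he : (0 : ℝ) < e := by exact_mod_cast h.2.1
  have hnp : ‖(p : E)‖ < 1 := by
    have : padicAbs h (p : E) = ‖(p : ℚ_[p])‖ := by
      rw [← padicAbs_algebraMap h, map_natCast (algebraMap ℚ_[p] E)]
    exact this.trans_lt Padic.norm_p_lt_one
  let _ : NontriviallyNormedField E :=
    { (inferInstance : NormedField E) with
      non_trivial := ⟨(p : E)⁻¹, by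
        rw [norm_inv]
        exact one_lt_inv_iff₀.2 ⟨norm_pos_iff.2 hp0, hnp⟩⟩ }
  let _ : NormedAlgebra ℚ_[p] E :=
    { ‹Algebra ℚ_[p] E› with
      norm_smul_le := fun r x => by
        rw [Algebra.smul_def, norm_mul]
        exact (congrArg (· * ‖x‖) (padicAbs_algebraMap h r)).le }
  have : CompleteSpace E := FiniteDimensional.complete ℚ_[p] E
  have hd : HasStrictDerivAt (fun x : E => x ^ p) ((p : E)) 1 := by
    simpa using hasStrictDerivAt_pow p (1 : E)
  have hmap := hd.map_nhds_eq hp0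
  have hrange : Set.range (fun x : E => x ^ p) ∈ nhds (1 : E) := by
    have := Filter.image_mem_map (m := fun x : E => x ^ p) (Filter.univ_mem (f := nhds (1 : E)))
    rw [hmap, one_pow, Set.image_univ] at this
    exact this
  obtain ⟨ε, hε, hball⟩ := Metric.mem_nhds_iff.1 hrange
  obtain ⟨n, hn⟩ := exists_pow_lt_of_lt_one hε (y := (p : ℝ)⁻¹) (inv_lt_one_of_one_lt₀ hp1)
  refine ⟨e * n + 1, fun x hx => ?_⟩
  have hx' : x ∈ Metric.ball (1 : E) ε := by
    rw [mem_ball_iff_norm]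
    refine lt_trans ?_ hn
    have h1 := (padicAbs_lt_one_iff h (x - 1) _).2 hx
    refine lt_of_lt_of_eq h1 ?_
    have : (-((((e * n + 1 : ℕ) : ℤ) : ℝ) - 1) / e : ℝ) = -(n : ℝ) := by
      push_cast
      field_simp
      ring
    rw [this, Real.rpow_neg (by positivity), Real.rpow_natCast, inv_pow]
  exact hball hx'

end Topology

section PrimePower

/-- The binomial expansion of `(1 + X) ^ ℓ` for `ℓ` prime. -/
lemma exists_one_add_pow_prime {ℓ : ℕ} (hℓ : ℓ.Prime) : ∃ s : Polynomial ℤ,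
    (1 + Polynomial.X) ^ ℓ =
      1 + Polynomial.X ^ ℓ + (ℓ : Polynomial ℤ) * Polynomial.X * (1 + Polynomial.X * s) := by
  obtain ⟨r, hr⟩ := exists_add_pow_prime_eq hℓ (1 : Polynomial ℤ) Polynomial.X
  have h1 : r.coeff 0 = 1 := by
    have h := congrArg (fun f => Polynomial.coeff f 1) hr
    simp only [one_pow, mul_one] at h
    rw [add_comm (1 : Polynomial ℤ) Polynomial.X, Polynomial.coeff_X_add_one_pow,
      Polynomial.coeff_add, Polynomial.coeff_add, Polynomial.coeff_X_pow,
      if_neg hℓ.one_lt.ne, Polynomial.coeff_one, if_neg one_ne_zero, mul_assoc,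
      Polynomial.coeff_natCast_mul, Polynomial.coeff_X_mul, Nat.choose_one_right] at h
    have h0 : (ℓ : ℤ) ≠ 0 := by exact_mod_cast hℓ.ne_zero
    refine mul_left_cancel₀ h0 ?_
    linarith
  refine ⟨r.divX, ?_⟩
  have h2 : 1 + Polynomial.X * r.divX = r := by
    conv_rhs => rw [← Polynomial.X_mul_divX_add r, h1, add_comm]
    simp
  rw [h2, hr]
  simp

variable {E : Type*} [Field E] {v : AddValuation E (WithTop ℤ)}

lemma exists_one_add_pow_eq {ℓ : ℕ} (hℓ : ℓ.Prime) {y : E} (hy : LevelGE v 0 y) :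
    ∃ s : E, LevelGE v 0 s ∧ (1 + y) ^ ℓ = 1 + y ^ ℓ + ℓ * y * (1 + y * s) := by
  obtain ⟨s, hs⟩ := exists_one_add_pow_prime hℓ
  refine ⟨Polynomial.aeval y s, hy.aeval s, ?_⟩
  simpa using congrArg (Polynomial.aeval y) hs

lemma levelGE_one_of_pow {ℓ : ℕ} (hℓ : ℓ ≠ 0) {y : E} (h : LevelGE v 1 (y ^ ℓ)) :
    LevelGE v 1 y := by
  by_cases hy : y = 0
  · rw [hy]; exact LevelGE.zero 1
  obtain ⟨n, hn⟩ := exists_val (v := v) hy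
  rw [levelGE_iff (val_pow hn ℓ)] at h
  rw [levelGE_iff hn]
  by_contra hc
  have : (ℓ : ℤ) * n ≤ 0 := mul_nonpos_of_nonneg_of_nonpos (by positivity) (by omega)
  omega

lemma levelGE_pow_sub_pow {x y : E} {n : ℤ} (hx : LevelGE v 0 x) (hy : LevelGE v 0 y)
    (h : LevelGE v n (x - y)) (k : ℕ) : LevelGE v n (x ^ k - y ^ k) := by
  induction k with
  | zero => simpa using LevelGE.zero n
  | succ k ih =>
    have : x ^ (k + 1) - y ^ (k + 1) = (x ^ k - y ^ k) * x + y ^ k * (x - y) := by ring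
    rw [this]
    exact (ih.mul' hx (by simp)).add ((hy.pow0 k).mul' h (by simp))

/-- In residue characteristic `ℓ`, the `ℓ`-th power map is injective on residues. -/
lemma levelGE_sub_of_pow_sub {ℓ : ℕ} (hℓ : ℓ.Prime) (hv : LevelGE v 1 (ℓ : E)) {x y : E}
    (hx : LevelGE v 0 x) (hy : LevelGE v 0 y) (h : LevelGE v 1 (x ^ ℓ - y ^ ℓ)) :
    LevelGE v 1 (x - y) := by
  by_cases hy0 : LevelGE v 1 y
  · have h1 : LevelGE v 1 (y ^ ℓ) := (hy0.pow ℓ).mono (by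
      have := hℓ.one_lt
      omega)
    have h2 : LevelGE v 1 (x ^ ℓ) := by simpa using h.add h1
    exact (levelGE_one_of_pow hℓ.ne_zero h2).sub hy0
  · have hvy : v y = ((0 : ℤ) : WithTop ℤ) := val_eq_iff.2 ⟨hy, by simpa using hy0⟩
    have hd : LevelGE v 0 ((x - y) / y) := LevelGE.inv_mul hvy (hx.sub hy) (by omega)
    obtain ⟨s, hs, he⟩ := exists_one_add_pow_eq hℓ hd
    have hy1 := ne_zero_of_val hvy
    have h1 : 1 + (x - y) / y = x / y := by field_simp; ring
    have h2 : ((x - y) / y) ^ ℓ =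
        (x ^ ℓ - y ^ ℓ) / y ^ ℓ - ℓ * ((x - y) / y * (1 + (x - y) / y * s)) := by
      rw [h1, div_pow x] at he
      have : (x ^ ℓ - y ^ ℓ) / y ^ ℓ = x ^ ℓ / y ^ ℓ - 1 := by field_simp
      rw [this, he]
      ring
    have hyl : v (y ^ ℓ) = ((0 : ℤ) : WithTop ℤ) := by simpa using val_pow hvy ℓ
    have h3 : LevelGE v 1 (((x - y) / y) ^ ℓ) := by
      rw [h2]
      refine (LevelGE.inv_mul hyl h (by omega)).sub (hv.mul' (n := 0) ?_ (by omega))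
      exact hd.mul' (m := 0) (n := 0)
        (LevelGE.one.add (hd.mul' (m := 0) (n := 0) hs (by omega))) (by omega)
    have h4 := levelGE_one_of_pow hℓ.ne_zero h3
    have : x - y = (x - y) / y * y := by field_simp
    rw [this]
    exact h4.mul' hy (by omega)

lemma val_natCast_of_coprime {ℓ s : ℕ} (hv : LevelGE v 1 (ℓ : E)) (h : Nat.Coprime s ℓ) :
    v (s : E) = ((0 : ℤ) : WithTop ℤ) := by
  refine val_eq_iff.2 ⟨LevelGE.natCast s, fun hs => ?_⟩
  have hb : ((s * s.gcdA ℓ + ℓ * s.gcdB ℓ : ℤ) : E) = 1 := by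
    rw [← Nat.gcd_eq_gcd_ab, h]
    simp
  push_cast at hb
  have : LevelGE v 1 (1 : E) := by
    rw [← hb]
    exact (hs.mul' (LevelGE.intCast _) (by omega)).add (hv.mul' (LevelGE.intCast _) (by omega))
  rw [levelGE_iff val_one] at this
  omega

end PrimePower

section Difference

variable {A M : Type*} [Field A] [Field M] [Algebra A M] {ℓ : ℕ}
  {v : AddValuation M (WithTop ℤ)} {b q : ℤ}

lemma levelGE_iterate {σ : M ≃ₐ[A] M}
    (hD : ∀ n x, LevelGE v n x → LevelGE v (n + b) (σ x - x)) {n : ℤ} {x : M}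
    (hx : LevelGE v n x) (k : ℕ) : LevelGE v (n + k * b) ((fun y => σ y - y)^[k] x) := by
  induction k with
  | zero => simpa using hx
  | succ k ih =>
    rw [Function.iterate_succ_apply']
    exact (hD _ _ ih).mono (by push_cast; linarith)

lemma levelGE_choose (hℓ : ℓ.Prime) (hq : LevelGE v q (ℓ : M)) {k : ℕ} (hk : k + 1 < ℓ) :
    LevelGE v q (ℓ.choose (k + 1) : M) := by
  obtain ⟨c, hc⟩ := hℓ.dvd_choose_self (Nat.succ_ne_zero k) hk
  rw [hc, Nat.cast_mul]
  exact hq.mul' (LevelGE.natCast c) (by omega)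

end Difference

section Generator

variable {A M : Type*} [Field A] [Field M] [Algebra A M] [FiniteDimensional A M] [IsGalois A M]
  {ℓ : ℕ}

lemma sum_aut_eq_sum_range (hdeg : Module.finrank A M = ℓ) {σ : M ≃ₐ[A] M}
    (hσ : ∀ τ, τ ∈ Subgroup.zpowers σ) (x : M) :
    ∑ τ : M ≃ₐ[A] M, τ x = ∑ i ∈ Finset.range ℓ, (σ ^ i) x := by
  have horder : orderOf σ = ℓ := by
    rw [orderOf_eq_card_of_forall_mem_zpowers hσ, IsGalois.card_aut_eq_finrank, hdeg]
  rw [← IsCyclic.image_range_orderOf hσ, Finset.sum_image, horder]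
  intro i hi j hj hij
  exact pow_injOn_Iio_orderOf (by simpa using hi) (by simpa using hj) hij

/-- The trace in terms of powers of `σ - 1`. -/
lemma sum_aut_eq_sum_choose (hdeg : Module.finrank A M = ℓ) {σ : M ≃ₐ[A] M}
    (hσ : ∀ τ, τ ∈ Subgroup.zpowers σ) (x : M) :
    ∑ τ : M ≃ₐ[A] M, τ x =
      ∑ k ∈ Finset.range ℓ, (ℓ.choose (k + 1) : M) * (fun y => σ y - y)^[k] x := by
  rw [sum_aut_eq_sum_range hdeg hσ]
  let D : Module.End A M := σ.toLinearMap - 1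
  have hD : ∀ k, (D ^ k) x = (fun y => σ y - y)^[k] x := by
    intro k
    rw [Module.End.pow_apply]
    rfl
  have hs : ∀ i, ((D + 1) ^ i) x = (σ ^ i) x := by
    intro i
    have : D + 1 = σ.toLinearMap := by simp [D]
    rw [this, Module.End.pow_apply]
    induction i with
    | zero => rfl
    | succ i ih =>
      rw [Function.iterate_succ_apply', ih, pow_succ']
      rfl
  have h := congrArg (Polynomial.aeval D) (Polynomial.geom_sum_X_comp_X_add_one_eq_sum
    (R := A) ℓ)
  rw [Polynomial.aeval_comp] at h
  simp only [map_add, Polynomial.aeval_X, map_one, map_sum, map_pow, map_mul, map_natCast] at h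
  have h' := LinearMap.congr_fun h x
  simp only [LinearMap.sum_apply, hs] at h'
  rw [h']
  refine Finset.sum_congr rfl fun k _ => ?_
  rw [Module.End.mul_apply, hD, ← nsmul_one, LinearMap.smul_apply, Module.End.one_apply,
    nsmul_eq_mul]

variable {v : AddValuation M (WithTop ℤ)} {b q : ℤ}

/-- The ramification break `b` of a cyclic extension of prime degree `ℓ` satisfies
`(ℓ - 1) b ≤ v(ℓ)`. -/
lemma break_le (hℓ : ℓ.Prime) (hdeg : Module.finrank A M = ℓ) {σ : M ≃ₐ[A] M}
    (hσ : ∀ τ, τ ∈ Subgroup.zpowers σ)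
    (hD : ∀ n x, LevelGE v n x → LevelGE v (n + b) (σ x - x)) (hb : 1 ≤ b)
    (hq : v (ℓ : M) = (q : WithTop ℤ)) : (ℓ - 1) * b ≤ q := by
  by_contra hlt
  push Not at hlt
  have hσ1 : σ ≠ 1 := by
    rintro rfl
    have h1 : Nat.card (M ≃ₐ[A] M) = 1 := by
      rw [← orderOf_eq_card_of_forall_mem_zpowers hσ, orderOf_one]
    rw [IsGalois.card_aut_eq_finrank, hdeg] at h1
    exact hℓ.one_lt.ne' h1
  obtain ⟨x, hx⟩ : ∃ x, σ x ≠ x := by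
    by_contra h
    push Not at h
    exact hσ1 (AlgEquiv.ext h)
  set y := σ x - x with hy
  have hy0 : y ≠ 0 := sub_ne_zero.2 hx
  obtain ⟨n, hn⟩ := exists_val (v := v) hy0
  have htr : ∑ τ : M ≃ₐ[A] M, τ y = 0 := by
    simp only [hy, map_sub, Finset.sum_sub_distrib]
    rw [sub_eq_zero]
    exact Fintype.sum_equiv (Equiv.mulRight σ) _ _ fun τ => rfl
  obtain ⟨m, rfl⟩ : ∃ m, ℓ = m + 1 := ⟨ℓ - 1, by have := hℓ.pos; omega⟩
  rw [sum_aut_eq_sum_choose hdeg hσ, Finset.sum_range_succ'] at htr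
  simp only [zero_add, Nat.choose_one_right, Function.iterate_zero, id] at htr
  have hrest : LevelGE v (q + n + 1)
      (∑ k ∈ Finset.range m, ((m + 1).choose (k + 1 + 1) : M) *
        (fun y => σ y - y)^[k + 1] y) := by
    refine LevelGE.sum fun k hk => ?_
    have hit := levelGE_iterate hD (levelGE_of_eq hn) (k + 1)
    rw [Finset.mem_range] at hk
    rcases Nat.lt_or_ge (k + 1) m with h | h
    · refine (levelGE_choose hℓ (levelGE_of_eq hq) (k := k + 1) (by omega)).mul' hit ?_
      push_cast
      nlinarith
    · obtain rfl : m = k + 1 := by omega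
      refine (LevelGE.natCast _).mul' hit ?_
      push_cast at hlt ⊢
      linarith
  rw [add_eq_zero_iff_neg_eq] at htr
  have := hrest.neg
  rw [htr, levelGE_iff (val_mul hq hn)] at this
  omega

lemma levelGE_sum_aut (hℓ : ℓ.Prime) (hdeg : Module.finrank A M = ℓ) {σ : M ≃ₐ[A] M}
    (hσ : ∀ τ, τ ∈ Subgroup.zpowers σ)
    (hD : ∀ n x, LevelGE v n x → LevelGE v (n + b) (σ x - x)) (hb : 0 ≤ b)
    (hq : LevelGE v q (ℓ : M)) (hbq : (ℓ - 1) * b ≤ q) {n : ℤ} {x : M} (hx : LevelGE v n x) :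
    LevelGE v (n + (ℓ - 1) * b) (∑ τ : M ≃ₐ[A] M, τ x) := by
  rw [sum_aut_eq_sum_choose hdeg hσ]
  refine LevelGE.sum fun k hk => ?_
  have hit := levelGE_iterate hD hx k
  rw [Finset.mem_range] at hk
  rcases Nat.lt_or_ge (k + 1) ℓ with h | h
  · refine (levelGE_choose hℓ hq h).mul' hit ?_
    have : (0 : ℤ) ≤ k * b := by positivity
    linarith
  · obtain rfl : ℓ = k + 1 := by omega
    refine (LevelGE.natCast _).mul' hit ?_
    push_cast
    linarith

end Generator

section Symmetric

variable {ι M : Type*} [Fintype ι] [Field M] {v : AddValuation M (WithTop ℤ)}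

/-- If all power sums have level `≥ B`, so have the elementary symmetric functions of degree
prime to the residue characteristic. -/
lemma levelGE_esymm {ℓ : ℕ} (hℓ : ℓ.Prime) (hv : LevelGE v 1 (ℓ : M)) {f : ι → M} {B : ℤ}
    (hf : ∀ i, LevelGE v 0 (f i)) (hB : ∀ j : ℕ, 1 ≤ j → LevelGE v B (∑ i, f i ^ j))
    {s : ℕ} (h1 : 1 ≤ s) (hs : s < ℓ) :
    LevelGE v B (∑ t ∈ Finset.powersetCard s Finset.univ, ∏ i ∈ t, f i) := by
  have hN := congrArg (MvPolynomial.aeval f) (MvPolynomial.mul_esymm_eq_sum ι ℤ s)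
  simp only [map_mul, map_natCast, map_sum, map_pow, map_neg, map_one, MvPolynomial.esymm,
    MvPolynomial.psum, map_prod, MvPolynomial.aeval_X] at hN
  have hsv := val_natCast_of_coprime hv
    (Nat.coprime_of_lt_prime (by omega) hs hℓ).symm
  have hsum : LevelGE v B ((s : M) *
      ∑ t ∈ Finset.powersetCard s Finset.univ, ∏ i ∈ t, f i) := by
    rw [hN]
    have hsign : ∀ k : ℕ, LevelGE v 0 ((-1 : M) ^ k) := fun k => LevelGE.one.neg.pow0 k
    refine (hsign _).mul' (n := B) (LevelGE.sum fun a ha => ?_) (by omega)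
    rw [Finset.mem_filter, Finset.HasAntidiagonal.mem_antidiagonal] at ha
    refine LevelGE.mul' (m := 0) ((hsign _).mul' (n := 0) ?_ (by omega)) (hB a.2 (by omega))
      (by omega)
    exact LevelGE.sum fun t _ => by simpa using LevelGE.prod fun i (_ : i ∈ t) => hf i
  rw [show ∑ t ∈ Finset.powersetCard s Finset.univ, ∏ i ∈ t, f i =
    ((s : M) * ∑ t ∈ Finset.powersetCard s Finset.univ, ∏ i ∈ t, f i) / s by
      field_simp [ne_zero_of_val hsv]]
  exact LevelGE.inv_mul hsv hsum (by omega)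

lemma levelGE_prod_one_add {ℓ : ℕ} (hℓ : ℓ.Prime) (hv : LevelGE v 1 (ℓ : M))
    (hcard : Fintype.card ι = ℓ) {f : ι → M} {B : ℤ}
    (hf : ∀ i, LevelGE v 0 (f i)) (hB : ∀ j : ℕ, 1 ≤ j → LevelGE v B (∑ i, f i ^ j)) :
    LevelGE v B (∏ i, (1 + f i) - 1 - ∏ i, f i) := by
  obtain ⟨m, rfl⟩ : ∃ m, ℓ = m + 1 := ⟨ℓ - 1, by have := hℓ.pos; omega⟩
  have hsplit : ∏ i, (1 + f i) - 1 - ∏ i, f i =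
      ∑ s ∈ Finset.range m,
        ∑ t ∈ Finset.powersetCard (s + 1) Finset.univ, ∏ i ∈ t, f i := by
    rw [Finset.prod_one_add, Finset.sum_powerset, Finset.card_univ, hcard,
      Finset.sum_range_succ, Finset.sum_range_succ', ← hcard, ← Finset.card_univ,
      Finset.powersetCard_self]
    simp only [Finset.sum_singleton, Finset.powersetCard_zero, Finset.prod_empty]
    ring
  rw [hsplit]
  refine LevelGE.sum fun s hs => levelGE_esymm hℓ hv hf hB (by omega) ?_
  have := Finset.mem_range.1 hs
  omega

end Symmetric

section Extension

variable {A M : Type*} [Field A] [Field M] [Algebra A M]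
  {vA : AddValuation A (WithTop ℤ)} {vM : AddValuation M (WithTop ℤ)} {e : ℕ}

lemma Extends.val_map (h : Extends vA vM e) {x : A} {n : ℤ} (hx : vA x = (n : WithTop ℤ)) :
    vM (algebraMap A M x) = ((e * n : ℤ) : WithTop ℤ) := by
  rw [h.2, hx, ← WithTop.coe_nsmul, nsmul_eq_mul]

lemma Extends.levelGE_map_iff (h : Extends vA vM e) {x : A} {n : ℤ} :
    LevelGE vM (e * n) (algebraMap A M x) ↔ LevelGE vA n x := by
  by_cases hx : x = 0
  · simp [hx, LevelGE.zero]
  obtain ⟨m, hm⟩ := exists_val (v := vA) hx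
  have he : (0 : ℤ) < e := by exact_mod_cast h.1
  rw [levelGE_iff hm, levelGE_iff (h.val_map hm), mul_le_mul_iff_right₀ he]

lemma Extends.levelGE_of_map (h : Extends vA vM e) {x : A} {n k : ℤ}
    (hx : LevelGE vM k (algebraMap A M x)) (hk : e * (n - 1) < k) : LevelGE vA n x := by
  by_cases hx0 : x = 0
  · rw [hx0]; exact LevelGE.zero n
  obtain ⟨m, hm⟩ := exists_val (v := vA) hx0
  have he : (0 : ℤ) < e := by exact_mod_cast h.1
  rw [levelGE_iff (h.val_map hm)] at hx
  rw [levelGE_iff hm]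
  have := lt_of_mul_lt_mul_left (lt_of_lt_of_le hk hx) he.le
  omega

lemma GalInvariant.levelGE_iff (h : GalInvariant A vM) (σ : M ≃ₐ[A] M) {n : ℤ} {x : M} :
    LevelGE vM n (σ x) ↔ LevelGE vM n x := by
  unfold LevelGE
  rw [h]

variable [FiniteDimensional A M] [IsGalois A M]

lemma val_norm (h : GalInvariant A vM) {x : M} {n : ℤ} (hx : vM x = (n : WithTop ℤ)) :
    vM (algebraMap A M (Algebra.norm A x)) = ((Module.finrank A M * n : ℤ) : WithTop ℤ) := by
  rw [Algebra.norm_eq_prod_automorphisms]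
  have : ∀ s : Finset (M ≃ₐ[A] M), vM (∏ σ ∈ s, σ x) = ((s.card * n : ℤ) : WithTop ℤ) := by
    intro s
    induction s using Finset.induction_on with
    | empty => simp
    | insert a s ha ih =>
      rw [Finset.prod_insert ha, Finset.card_insert_of_notMem ha,
        val_mul ((h a x).trans hx) ih]
      congr 1
      push_cast
      ring
  rw [this, Finset.card_univ, ← Nat.card_eq_fintype_card, IsGalois.card_aut_eq_finrank]

lemma levelGE_norm (h : GalInvariant A vM) {x : M} {n : ℤ} (hx : LevelGE vM n x) :
    LevelGE vM (Module.finrank A M * n) (algebraMap A M (Algebra.norm A x)) := by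
  rw [Algebra.norm_eq_prod_automorphisms]
  have := LevelGE.prod (s := Finset.univ) fun (σ : M ≃ₐ[A] M) _ => (h.levelGE_iff σ).2 hx
  rwa [Finset.card_univ, ← Nat.card_eq_fintype_card, IsGalois.card_aut_eq_finrank] at this

/-- The ramification index divides the degree. -/
lemma exists_val_norm (hext : Extends vA vM e) (h : GalInvariant A vM) {x : M} {n : ℤ}
    (hx : vM x = (n : WithTop ℤ)) : ∃ m : ℤ, vA (Algebra.norm A x) = (m : WithTop ℤ) ∧
      (e : ℤ) * m = Module.finrank A M * n := by
  have h0 : Algebra.norm A x ≠ 0 := Algebra.norm_ne_zero_iff.2 (ne_zero_of_val hx)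
  obtain ⟨m, hm⟩ := exists_val (v := vA) h0
  refine ⟨m, hm, ?_⟩
  have := hext.val_map (vM := vM) hm
  rw [val_norm h hx, WithTop.coe_inj] at this
  exact this.symm

end Extension

section TotallyRamified

variable {A M : Type*} [Field A] [Field M] [Algebra A M]
  {vA : AddValuation A (WithTop ℤ)} {vM : AddValuation M (WithTop ℤ)} {ℓ : ℕ} {ϖ : M}

lemma levelGE_of_sum_uniformizer (hext : Extends vA vM ℓ)
    (hϖ : vM ϖ = ((1 : ℤ) : WithTop ℤ)) {a : Fin ℓ → A} {n : ℤ}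
    (h : LevelGE vM n (∑ i, algebraMap A M (a i) * ϖ ^ (i : ℕ))) (i : Fin ℓ) :
    LevelGE vM n (algebraMap A M (a i) * ϖ ^ (i : ℕ)) := by
  refine LevelGE.of_sum_distinct (fun i _ j _ hij h0 heq => hij ?_) h i (Finset.mem_univ i)
  have hi0 : a i ≠ 0 := by
    intro hi
    simp [hi] at h0
  obtain ⟨m, hm⟩ := exists_val (v := vA) hi0
  have hj0 : a j ≠ 0 := by
    intro hj
    rw [hj, map_zero, zero_mul, vM.map_zero, vM.top_iff] at heq
    exact h0 heq
  obtain ⟨k, hk⟩ := exists_val (v := vA) hj0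
  rw [val_mul (hext.val_map hm) (val_pow hϖ _), val_mul (hext.val_map hk) (val_pow hϖ _),
    WithTop.coe_inj, mul_one, mul_one] at heq
  have h2 : ((i : ℕ) : ℤ) = j := by
    have := congrArg (· % (ℓ : ℤ)) heq
    simp only [Int.mul_add_emod_self_left] at this
    rwa [Int.emod_eq_of_lt (by omega) (by have := i.2; omega),
      Int.emod_eq_of_lt (by omega) (by have := j.2; omega)] at this
  exact Fin.ext (by exact_mod_cast h2)

variable [FiniteDimensional A M]

/-- In a totally ramified extension the powers of a uniformizer span. -/
lemma exists_eq_sum_uniformizer (hext : Extends vA vM ℓ)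
    (hϖ : vM ϖ = ((1 : ℤ) : WithTop ℤ)) (hdeg : Module.finrank A M = ℓ) (x : M) :
    ∃ a : Fin ℓ → A, x = ∑ i, algebraMap A M (a i) * ϖ ^ (i : ℕ) := by
  have hli : LinearIndependent A fun i : Fin ℓ => ϖ ^ (i : ℕ) := by
    rw [Fintype.linearIndependent_iff]
    intro g hg i
    simp only [Algebra.smul_def] at hg
    have h : algebraMap A M (g i) * ϖ ^ (i : ℕ) = 0 :=
      eq_zero_of_levelGE (v := vM) fun n =>
        levelGE_of_sum_uniformizer hext hϖ (by rw [hg]; exact LevelGE.zero n) i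
    simpa [ne_zero_of_val hϖ] using h
  have hspan := hli.span_eq_top_of_card_eq_finrank' (by simp [hdeg])
  have hx : x ∈ Submodule.span A (Set.range fun i : Fin ℓ => ϖ ^ (i : ℕ)) := by
    rw [hspan]; trivial
  obtain ⟨a, ha⟩ := (Submodule.mem_span_range_iff_exists_fun A).1 hx
  exact ⟨a, by rw [← ha]; simp only [Algebra.smul_def]⟩

/-- A totally ramified extension has trivial residue extension. -/
lemma exists_residue (hℓ : 0 < ℓ) (hext : Extends vA vM ℓ)
    (hϖ : vM ϖ = ((1 : ℤ) : WithTop ℤ)) (hdeg : Module.finrank A M = ℓ) {x : M}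
    (hx : LevelGE vM 0 x) :
    ∃ a : A, LevelGE vA 0 a ∧ LevelGE vM 1 (x - algebraMap A M a) := by
  obtain ⟨a, rfl⟩ := exists_eq_sum_uniformizer hext hϖ hdeg x
  obtain ⟨m, rfl⟩ : ∃ m, ℓ = m + 1 := ⟨ℓ - 1, by omega⟩
  have h := levelGE_of_sum_uniformizer hext hϖ hx
  have ha : ∀ i, LevelGE vA 0 (a i) := by
    intro i
    have hi := LevelGE.inv_mul (val_pow hϖ (i : ℕ)) (h i) le_rfl
    rw [mul_div_cancel_right₀ _ (pow_ne_zero _ (ne_zero_of_val hϖ))] at hi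
    refine hext.levelGE_of_map hi ?_
    have := i.2
    push_cast
    omega
  refine ⟨a 0, ha 0, ?_⟩
  rw [Fin.sum_univ_succ]
  simp only [Fin.val_zero, pow_zero, mul_one, add_sub_cancel_left]
  refine LevelGE.sum fun i _ => ?_
  refine (hext.levelGE_map_iff.2 (ha i.succ)).mul' (levelGE_of_eq (val_pow hϖ _)) ?_
  rw [Fin.val_succ]
  push_cast
  omega

/-- The action of `σ` on a uniformizer controls its action everywhere. -/
lemma levelGE_sub_of_uniformizer (hext : Extends vA vM ℓ)
    (hϖ : vM ϖ = ((1 : ℤ) : WithTop ℤ)) (hdeg : Module.finrank A M = ℓ)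
    {σ : M ≃ₐ[A] M} {b : ℤ} (hb : 0 ≤ b) (hσ : LevelGE vM b (σ ϖ / ϖ - 1)) (n : ℤ) (x : M)
    (hx : LevelGE vM n x) : LevelGE vM (n + b) (σ x - x) := by
  obtain ⟨a, rfl⟩ := exists_eq_sum_uniformizer hext hϖ hdeg x
  have h := levelGE_of_sum_uniformizer hext hϖ hx
  rw [map_sum, ← Finset.sum_sub_distrib]
  refine LevelGE.sum fun i _ => ?_
  have hpow : ∀ k : ℕ, LevelGE vM b ((σ ϖ / ϖ) ^ k - 1) := by
    intro k
    induction k with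
    | zero => simpa using LevelGE.zero b
    | succ k ih =>
      rw [pow_succ]
      exact ih.mul_sub_one hb hσ
  have : σ (algebraMap A M (a i) * ϖ ^ (i : ℕ)) - algebraMap A M (a i) * ϖ ^ (i : ℕ) =
      algebraMap A M (a i) * ϖ ^ (i : ℕ) * ((σ ϖ / ϖ) ^ (i : ℕ) - 1) := by
    have hϖ0 := ne_zero_of_val hϖ
    rw [map_mul, map_pow, σ.commutes, div_pow]
    have := pow_ne_zero (i : ℕ) hϖ0
    field_simp
  rw [this]
  exact (h i).mul (hpow i)

end TotallyRamified

section Norm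

variable {A M : Type*} [Field A] [Field M] [Algebra A M]
  {vA : AddValuation A (WithTop ℤ)} {vM : AddValuation M (WithTop ℤ)} {e : ℕ}

lemma LevelGE.prod_sub_pow {ι : Type*} {s : Finset ι} {f : ι → M} {c : M} {n : ℤ}
    (hf : ∀ i ∈ s, LevelGE vM 0 (f i)) (hc : LevelGE vM 0 c)
    (h : ∀ i ∈ s, LevelGE vM n (f i - c)) : LevelGE vM n (∏ i ∈ s, f i - c ^ s.card) := by
  induction s using Finset.induction_on with
  | empty => simpa using LevelGE.zero n
  | insert a s ha ih =>
    rw [Finset.prod_insert ha, Finset.card_insert_of_notMem ha, pow_succ']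
    have : f a * ∏ i ∈ s, f i - c * c ^ s.card =
        f a * (∏ i ∈ s, f i - c ^ s.card) + (f a - c) * c ^ s.card := by ring
    rw [this]
    refine LevelGE.add ?_ ?_
    · exact (hf a (Finset.mem_insert_self a s)).mul' (ih
        (fun i hi => hf i (Finset.mem_insert_of_mem hi))
        fun i hi => h i (Finset.mem_insert_of_mem hi)) (by omega)
    · exact (h a (Finset.mem_insert_self a s)).mul' (hc.pow0 _) (by omega)

variable [FiniteDimensional A M] [IsGalois A M]

lemma levelGE_norm_sub_pow (hext : Extends vA vM e) (h : GalInvariant A vM) {w : M} {a : A}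
    (hw : LevelGE vM 0 w) (ha : LevelGE vA 0 a) (hwa : LevelGE vM 1 (w - algebraMap A M a)) :
    LevelGE vA 1 (Algebra.norm A w - a ^ Module.finrank A M) := by
  refine hext.levelGE_of_map (k := 1) ?_ (by simp)
  rw [map_sub, map_pow, Algebra.norm_eq_prod_automorphisms, ← IsGalois.card_aut_eq_finrank,
    Nat.card_eq_fintype_card, ← Finset.card_univ]
  refine LevelGE.prod_sub_pow (fun τ _ => (h.levelGE_iff τ).2 hw)
    (by simpa using hext.levelGE_map_iff.2 ha) fun τ _ => ?_
  rw [← τ.commutes a, ← map_sub]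
  exact (h.levelGE_iff τ).2 hwa

lemma val_eq_zero_of_norm (hext : Extends vA vM e) (h : GalInvariant A vM) {w : M}
    (hw : vA (Algebra.norm A w) = ((0 : ℤ) : WithTop ℤ)) : vM w = ((0 : ℤ) : WithTop ℤ) := by
  have hw0 : w ≠ 0 := Algebra.norm_ne_zero_iff.1 (ne_zero_of_val hw)
  obtain ⟨n, hn⟩ := exists_val (v := vM) hw0
  obtain ⟨m, hm, hmn⟩ := exists_val_norm hext h hn
  rw [hw, WithTop.coe_inj] at hm
  rw [← hm, mul_zero] at hmn
  have : n = 0 := by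
    have := Module.finrank_pos (R := A) (M := M)
    rcases mul_eq_zero.1 hmn.symm with h | h
    · exact absurd (by exact_mod_cast h) this.ne'
    · exact h
  rw [hn, this]

lemma algebraNorm_div {x y : M} (hy : y ≠ 0) :
    Algebra.norm A (x / y) = Algebra.norm A x / Algebra.norm A y := by
  rw [eq_div_iff (Algebra.norm_ne_zero_iff.2 hy), ← map_mul, div_mul_cancel₀ _ hy]

lemma norm_div_self_eq_one {σ : M ≃ₐ[A] M} {ϖ : M} (hϖ : ϖ ≠ 0) :
    Algebra.norm A (σ ϖ / ϖ) = 1 := by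
  rw [algebraNorm_div hϖ, Algebra.norm_eq_of_algEquiv, div_self (Algebra.norm_ne_zero_iff.2 hϖ)]

end Norm

/-- `M/A` is a wildly and totally ramified extension of prime degree `ℓ`, with uniformizer `ϖ`,
generator `σ` of the Galois group, and ramification break `b`. -/
structure IsWild {A M : Type*} [Field A] [Field M] [Algebra A M]
    (vA : AddValuation A (WithTop ℤ)) (vM : AddValuation M (WithTop ℤ)) (ℓ : ℕ) (ϖ : M)
    (σ : M ≃ₐ[A] M) (b : ℤ) : Prop where
  prime : ℓ.Prime
  ext : Extends vA vM ℓ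
  inv : GalInvariant A vM
  unif : vM ϖ = ((1 : ℤ) : WithTop ℤ)
  deg : Module.finrank A M = ℓ
  gen : ∀ τ, τ ∈ Subgroup.zpowers σ
  ne_zero : (ℓ : M) ≠ 0
  pos : 1 ≤ b
  break_eq : vM (σ ϖ / ϖ - 1) = (b : WithTop ℤ)

namespace IsWild

variable {A M : Type*} [Field A] [Field M] [Algebra A M] [FiniteDimensional A M]
  {vA : AddValuation A (WithTop ℤ)} {vM : AddValuation M (WithTop ℤ)} {ℓ : ℕ} {ϖ : M}
  {σ : M ≃ₐ[A] M} {b : ℤ}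

lemma levelGE_sub (h : IsWild vA vM ℓ ϖ σ b) (n : ℤ) (x : M) (hx : LevelGE vM n x) :
    LevelGE vM (n + b) (σ x - x) :=
  levelGE_sub_of_uniformizer h.ext h.unif h.deg (by have := h.pos; omega)
    (levelGE_of_eq h.break_eq) n x hx

variable [IsGalois A M]

lemma break_le_val (h : IsWild vA vM ℓ ϖ σ b) {q : ℤ} (hq : vM (ℓ : M) = (q : WithTop ℤ)) :
    (ℓ - 1) * b ≤ q :=
  break_le h.prime h.deg h.gen h.levelGE_sub h.pos hq

lemma levelGE_natCast (h : IsWild vA vM ℓ ϖ σ b) : LevelGE vM ((ℓ - 1) * b) (ℓ : M) := by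
  obtain ⟨q, hq⟩ := exists_val (v := vM) h.ne_zero
  exact (levelGE_of_eq hq).mono (h.break_le_val hq)

lemma levelGE_natCast_one (h : IsWild vA vM ℓ ϖ σ b) : LevelGE vM 1 (ℓ : M) := by
  refine h.levelGE_natCast.mono ?_
  have h1 : (2 : ℤ) ≤ ℓ := by exact_mod_cast h.prime.two_le
  nlinarith [h.pos]

lemma levelGE_norm_one_add (h : IsWild vA vM ℓ ϖ σ b) {n : ℤ} (hn : 0 ≤ n) {y : M}
    (hy : LevelGE vM n y) : LevelGE vM (n + (ℓ - 1) * b)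
      (algebraMap A M (Algebra.norm A (1 + y)) - 1 - algebraMap A M (Algebra.norm A y)) := by
  rw [Algebra.norm_eq_prod_automorphisms, Algebra.norm_eq_prod_automorphisms]
  simp only [map_add, map_one]
  refine levelGE_prod_one_add h.prime h.levelGE_natCast_one ?_
    (fun τ => (h.inv.levelGE_iff τ).2 (hy.mono hn)) fun j hj => ?_
  · rw [← Nat.card_eq_fintype_card, IsGalois.card_aut_eq_finrank, h.deg]
  · simp only [← map_pow]
    refine levelGE_sum_aut h.prime h.deg h.gen h.levelGE_sub (by have := h.pos; omega)
      h.levelGE_natCast le_rfl ((hy.pow j).mono ?_)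
    have : (1 : ℤ) ≤ j := by exact_mod_cast hj
    nlinarith

lemma not_levelGE_norm (h : IsWild vA vM ℓ ϖ σ b) {n : ℤ} (hn : 1 ≤ n) (hnb : n < b) {y : M}
    (hy : vM y = (n : WithTop ℤ)) : ¬ LevelGE vA b (Algebra.norm A (1 + y) - 1) := by
  intro hN
  have h1 : (2 : ℤ) ≤ ℓ := by exact_mod_cast h.prime.two_le
  have h2 := h.ext.levelGE_map_iff.2 hN
  rw [map_sub, map_one] at h2
  have h3 := h.levelGE_norm_one_add (by omega) (levelGE_of_eq hy)
  have h4 := (h2.mono (m := ℓ * n + 1) (by nlinarith)).sub (h3.mono (by nlinarith))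
  rw [sub_sub_cancel, levelGE_iff (val_norm h.inv hy), h.deg] at h4
  omega

lemma levelGE_norm_break (h : IsWild vA vM ℓ ϖ σ b) {y : M} (hy : LevelGE vM b y) :
    LevelGE vA b (Algebra.norm A (1 + y) - 1) := by
  have hb := h.pos
  have h1 : (2 : ℤ) ≤ ℓ := by exact_mod_cast h.prime.two_le
  have h3 := h.levelGE_norm_one_add (by omega) hy
  have h4 := levelGE_norm h.inv hy
  rw [h.deg] at h4
  rw [← h.ext.levelGE_map_iff, map_sub, map_one]
  have := (h3.mono (m := ℓ * b) (by linarith)).add h4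
  rwa [sub_add_cancel] at this

lemma levelGE_norm_break_succ (h : IsWild vA vM ℓ ϖ σ b) {y : M} (hy : LevelGE vM (b + 1) y) :
    LevelGE vA (b + 1) (Algebra.norm A (1 + y) - 1) := by
  have hb := h.pos
  have h1 : (2 : ℤ) ≤ ℓ := by exact_mod_cast h.prime.two_le
  have h3 := h.levelGE_norm_one_add (by omega) hy
  have h4 := levelGE_norm h.inv hy
  rw [h.deg] at h4
  refine h.ext.levelGE_of_map (k := ℓ * b + 1) ?_ (by rw [add_sub_cancel_right]; omega)
  rw [map_sub, map_one]
  have := (h3.mono (m := ℓ * b + 1) (by linarith)).add (h4.mono (by linarith))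
  rwa [sub_add_cancel] at this

lemma levelGE_norm_sub_norm (h : IsWild vA vM ℓ ϖ σ b) {w w' : M}
    (hw : vM w' = ((0 : ℤ) : WithTop ℤ)) (hww : LevelGE vM (b + 1) (w - w')) :
    LevelGE vA (b + 1) (Algebra.norm A w - Algebra.norm A w') := by
  have h1 := h.levelGE_norm_break_succ (hww.div_sub_one' hw)
  rw [add_sub_cancel, algebraNorm_div (ne_zero_of_val hw)] at h1
  obtain ⟨m, hm, hmn⟩ := exists_val_norm h.ext h.inv hw
  have : m = 0 := by
    rw [mul_zero] at hmn
    rcases mul_eq_zero.1 hmn with h' | h'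
    · exact absurd (by exact_mod_cast h') h.prime.ne_zero
    · exact h'
  rw [this] at hm
  exact h1.sub_of_div hm

/-- In a wildly ramified extension of prime degree with break `b`, not all classes in `U^b/U^{b+1}`
contain norms. -/
theorem exists_not_norm (h : IsWild vA vM ℓ ϖ σ b) [Finite (Residues vA)] :
    ∃ z : A, LevelGE vA b (z - 1) ∧
      ∀ w : M, ¬ LevelGE vA (b + 1) (Algebra.norm A w - z) := by
  by_contra! hcon
  have hb := h.pos
  have hℓ := h.prime.pos
  have hℓ1 : (1 : ℤ) ≤ ℓ := by exact_mod_cast hℓ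
  set π := Algebra.norm A ϖ with hπdef
  have hπ : vA π = ((1 : ℤ) : WithTop ℤ) := by
    obtain ⟨m, hm, hmn⟩ := exists_val_norm h.ext h.inv h.unif
    rw [h.deg] at hmn
    have : m = 1 := mul_left_cancel₀ (by omega) hmn
    rw [hm, this]
  have hπb : vA (π ^ b) = (b : WithTop ℤ) := by simpa using val_zpow hπ b
  have hϖb : vM (ϖ ^ b) = (b : WithTop ℤ) := by simpa using val_zpow h.unif b
  have hπ0 := ne_zero_of_val hπb
  let g : A → A := fun a => (Algebra.norm A (1 + algebraMap A M a * ϖ ^ b) - 1) / π ^ b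
  have hmap : ∀ {a : A}, LevelGE vA 0 a → LevelGE vM b (algebraMap A M a * ϖ ^ b) := fun ha =>
    (h.ext.levelGE_map_iff.2 ha).mul' (levelGE_of_eq hϖb) (by omega)
  have hunit : ∀ {y : M}, LevelGE vM b y → vM (1 + y) = ((0 : ℤ) : WithTop ℤ) := fun hy =>
    val_of_sub_one hb (by simpa using hy)
  have hg0 : ∀ a, LevelGE vA 0 a → LevelGE vA 0 (g a) := fun a ha =>
    LevelGE.inv_mul hπb (h.levelGE_norm_break (hmap ha)) (by omega)
  have hgc : ∀ {a : A} {w : M}, LevelGE vA 0 a →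
      LevelGE vM (b + 1) (w - 1 - algebraMap A M a * ϖ ^ b) →
      LevelGE vA 1 (g a - (Algebra.norm A w - 1) / π ^ b) := by
    intro a w ha hw
    have h1 := h.levelGE_norm_sub_norm (w := w) (hunit (hmap ha)) (by
      rwa [sub_sub] at hw)
    have h3 := (LevelGE.inv_mul hπb h1 (k := 1) (by omega)).neg
    convert h3 using 1
    simp only [g]
    ring
  have hres : ∀ y : M, LevelGE vM b y →
      ∃ a : A, LevelGE vA 0 a ∧ LevelGE vM (b + 1) (y - algebraMap A M a * ϖ ^ b) := by
    intro y hy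
    obtain ⟨a, ha, hya⟩ := exists_residue hℓ h.ext h.unif h.deg
      (LevelGE.inv_mul hϖb hy (k := 0) (by omega))
    refine ⟨a, ha, ?_⟩
    have := hya.mul (levelGE_of_eq hϖb)
    rw [sub_mul, div_mul_cancel₀ _ (ne_zero_of_val hϖb)] at this
    exact this.mono (by omega)
  have hgr : ∀ x y, LevelGE vA 0 x → LevelGE vA 0 y → LevelGE vA 1 (x - y) →
      LevelGE vA 1 (g x - g y) := by
    intro x y hx hy hxy
    refine hgc hx ?_
    rw [add_sub_cancel_left, ← sub_mul, ← map_sub]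
    exact (h.ext.levelGE_map_iff.2 (hxy.sub_comm)).mul' (levelGE_of_eq hϖb) (by omega)
  have hsurj : ∀ r, LevelGE vA 0 r → ∃ x, LevelGE vA 0 x ∧ LevelGE vA 1 (g x - r) := by
    intro r hr
    have hz : LevelGE vA b (1 + r * π ^ b - 1) := by
      rw [add_sub_cancel_left]
      exact hr.mul' (levelGE_of_eq hπb) (by omega)
    obtain ⟨w, hw⟩ := hcon _ hz
    have hNw : LevelGE vA b (Algebra.norm A w - 1) := (hw.mono (by omega)).trans hz
    have hw0 := val_eq_zero_of_norm h.ext h.inv (val_of_sub_one hb hNw)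
    obtain ⟨a, ha, hwa⟩ := exists_residue hℓ h.ext h.unif h.deg (levelGE_of_eq hw0)
    have hpow := levelGE_norm_sub_pow h.ext h.inv (levelGE_of_eq hw0) ha hwa
    rw [h.deg] at hpow
    have hℓA : LevelGE vA 1 (ℓ : A) := by
      refine h.ext.levelGE_of_map (k := 1) ?_ (by simp)
      simpa using h.levelGE_natCast_one
    have ha1 : LevelGE vA 1 (a - 1) := by
      refine levelGE_sub_of_pow_sub h.prime hℓA ha LevelGE.one ?_
      rw [one_pow]
      exact hpow.sub_comm.trans (hNw.mono hb)
    have hw1 : LevelGE vM 1 (w - 1) := by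
      refine hwa.trans ?_
      have := h.ext.levelGE_map_iff.2 ha1
      rw [map_sub, map_one] at this
      exact this.mono (by omega)
    have hwb : LevelGE vM b (w - 1) := by
      by_contra hnot
      obtain ⟨n, hn⟩ := exists_val (v := vM) (ne_zero_of_not_levelGE hnot)
      rw [levelGE_iff hn] at hw1 hnot
      refine h.not_levelGE_norm hw1 (not_le.1 hnot) hn ?_
      rwa [add_sub_cancel]
    obtain ⟨a', ha', hwa'⟩ := hres _ hwb
    refine ⟨a', ha', (hgc ha' hwa').trans ?_⟩
    have h3 := LevelGE.inv_mul hπb hw (k := 1) (by omega)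
    convert h3 using 1
    field_simp
    ring
  have hinj := residue_injective_of_surjective g hg0 hgr hsurj
  obtain ⟨a, ha, hya⟩ := hres _ (levelGE_of_eq h.break_eq)
  have h1 := hgc ha hya
  rw [norm_div_self_eq_one (ne_zero_of_val h.unif), sub_self, zero_div] at h1
  have h2 := hinj a 0 ha (LevelGE.zero 0) (by simpa [g] using h1)
  rw [sub_zero] at h2
  have h3 := hya.add
    ((h.ext.levelGE_map_iff.2 h2).mul' (levelGE_of_eq hϖb) (k := b + 1) (by omega))
  rw [sub_add_cancel, levelGE_iff h.break_eq] at h3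
  omega

end IsWild

section NormGroup

variable {A M : Type*} [Field A] [Field M] [Algebra A M] [FiniteDimensional A M]

lemma mem_normGroup_iff {u : Aˣ} : u ∈ normGroup A M ↔ ∃ w : M, Algebra.norm A w = u := by
  constructor
  · rintro ⟨w, rfl⟩
    exact ⟨w, rfl⟩
  · rintro ⟨w, hw⟩
    have hw0 : w ≠ 0 := by
      rw [← Algebra.norm_ne_zero_iff (R := A), hw]
      exact u.ne_zero
    exact ⟨Units.mk0 w hw0, Units.ext hw⟩

lemma exists_norm_eq_of_top (h : normGroup A M = ⊤) {x : A} (hx : x ≠ 0) :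
    ∃ w : M, Algebra.norm A w = x :=
  mem_normGroup_iff.1 (h ▸ Subgroup.mem_top (Units.mk0 x hx))

end NormGroup

section PrimeDegree

variable {A M : Type*} [Field A] [Field M] [Algebra A M] [FiniteDimensional A M]
  {vA : AddValuation A (WithTop ℤ)} {vM : AddValuation M (WithTop ℤ)} {ℓ e : ℕ} {ϖ : M}

lemma exists_break (hext : Extends vA vM ℓ) (hinv : GalInvariant A vM)
    (hϖ : vM ϖ = ((1 : ℤ) : WithTop ℤ)) (hdeg : Module.finrank A M = ℓ) {σ : M ≃ₐ[A] M}
    (hσ : σ ≠ 1) : ∃ b : ℤ, 0 ≤ b ∧ vM (σ ϖ / ϖ - 1) = (b : WithTop ℤ) := by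
  have h0 : LevelGE vM 0 (σ ϖ / ϖ - 1) :=
    (levelGE_of_eq (val_div ((hinv σ ϖ).trans hϖ) hϖ)).sub LevelGE.one
  have hne : σ ϖ / ϖ - 1 ≠ 0 := by
    intro hu
    refine hσ (AlgEquiv.ext fun x => sub_eq_zero.1 (eq_zero_of_levelGE (v := vM) fun n => ?_))
    by_cases hx : x = 0
    · simp [hx, LevelGE.zero]
    obtain ⟨m, hm⟩ := exists_val (v := vM) hx
    refine (levelGE_sub_of_uniformizer hext hϖ hdeg (b := max 0 (n - m)) (le_max_left _ _)
      (by rw [hu]; exact LevelGE.zero _) m x (levelGE_of_eq hm)).mono ?_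
    have := le_max_right 0 (n - m)
    omega
  obtain ⟨b, hb⟩ := exists_val (v := vM) hne
  exact ⟨b, (levelGE_iff hb).1 h0, hb⟩

variable [IsGalois A M]

lemma mem_zpowers_of_finrank_prime (hℓ : ℓ.Prime) (hdeg : Module.finrank A M = ℓ)
    {σ : M ≃ₐ[A] M} (hσ : σ ≠ 1) (τ : M ≃ₐ[A] M) : τ ∈ Subgroup.zpowers σ := by
  have : Fact ℓ.Prime := ⟨hℓ⟩
  exact mem_zpowers_of_prime_card ((IsGalois.card_aut_eq_finrank A M).trans hdeg) hσ

lemma exists_aut_ne_one (hℓ : ℓ.Prime) (hdeg : Module.finrank A M = ℓ) :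
    ∃ σ : M ≃ₐ[A] M, σ ≠ 1 := by
  have hc := (IsGalois.card_aut_eq_finrank A M).trans hdeg
  have : Nontrivial (M ≃ₐ[A] M) := by
    rw [← Finite.one_lt_card_iff_nontrivial, hc]
    exact hℓ.one_lt
  exact exists_ne 1

lemma ramification_eq_one_or (hℓ : ℓ.Prime) (hdeg : Module.finrank A M = ℓ)
    (hvM : IsNormalized vM) (hext : Extends vA vM e) (hinv : GalInvariant A vM) :
    e = 1 ∨ e = ℓ := by
  obtain ⟨ϖ, hϖ⟩ := hvM 1
  obtain ⟨m, hm, hmn⟩ := exists_val_norm hext hinv hϖ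
  rw [hdeg, mul_one] at hmn
  exact (Nat.dvd_prime hℓ).1 (Int.natCast_dvd_natCast.1 ⟨m, hmn.symm⟩)

lemma exists_residue_break (hℓ : ℓ.Prime) (hext : Extends vA vM ℓ) (hinv : GalInvariant A vM)
    (hϖ : vM ϖ = ((1 : ℤ) : WithTop ℤ)) (hdeg : Module.finrank A M = ℓ) (σ : M ≃ₐ[A] M) :
    ∃ a : A, LevelGE vA 0 a ∧ LevelGE vM 1 (σ ϖ / ϖ - algebraMap A M a) ∧
      LevelGE vA 1 (a ^ ℓ - 1) := by
  have hu := levelGE_of_eq (val_div ((hinv σ ϖ).trans hϖ) hϖ)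
  rw [sub_self] at hu
  obtain ⟨a, ha, hua⟩ := exists_residue hℓ.pos hext hϖ hdeg hu
  refine ⟨a, ha, hua, ?_⟩
  have := levelGE_norm_sub_pow hext hinv hu ha hua
  rw [norm_div_self_eq_one (ne_zero_of_val hϖ), hdeg] at this
  exact this.sub_comm

/-- If the residue characteristic is `ℓ`, a ramified extension of degree `ℓ` is wild. -/
lemma exists_isWild (hℓ : ℓ.Prime) (hext : Extends vA vM ℓ) (hinv : GalInvariant A vM)
    (hϖ : vM ϖ = ((1 : ℤ) : WithTop ℤ)) (hdeg : Module.finrank A M = ℓ) {σ : M ≃ₐ[A] M}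
    (hσ : σ ≠ 1) (hℓ0 : (ℓ : M) ≠ 0) (hv : LevelGE vA 1 (ℓ : A)) :
    ∃ b : ℤ, IsWild vA vM ℓ ϖ σ b := by
  obtain ⟨b, hb0, hb⟩ := exists_break hext hinv hϖ hdeg hσ
  obtain ⟨a, ha, hua, ha1⟩ := exists_residue_break hℓ hext hinv hϖ hdeg σ
  refine ⟨b, hℓ, hext, hinv, hϖ, hdeg, mem_zpowers_of_finrank_prime hℓ hdeg hσ, hℓ0, ?_, hb⟩
  rw [← levelGE_iff hb]
  refine hua.trans ?_
  have h1 := levelGE_sub_of_pow_sub hℓ hv ha LevelGE.one (by simpa using ha1)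
  have h2 := hext.levelGE_map_iff.2 h1
  rw [map_sub, map_one] at h2
  exact h2.mono (by have := hℓ.pos; omega)

/-- Norms are not surjective in a Galois extension of prime degree. -/
theorem normGroup_ne_top_of_prime (hℓ : ℓ.Prime) (hvA : IsNormalized vA) [Finite (Residues vA)]
    (hvM : IsNormalized vM) (hext : Extends vA vM e) (hinv : GalInvariant A vM)
    (hdeg : Module.finrank A M = ℓ) (hℓ0 : (ℓ : M) ≠ 0) : normGroup A M ≠ ⊤ := by
  intro htop
  obtain ⟨ϖ, hϖ⟩ := hvM 1
  rcases ramification_eq_one_or hℓ hdeg hvM hext hinv with rfl | rfl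
  · obtain ⟨π, hπ⟩ := hvA 1
    obtain ⟨w, hw⟩ := exists_norm_eq_of_top htop (ne_zero_of_val hπ)
    have hw0 : w ≠ 0 := by
      rw [← Algebra.norm_ne_zero_iff (R := A), hw]
      exact ne_zero_of_val hπ
    obtain ⟨n, hn⟩ := exists_val (v := vM) hw0
    obtain ⟨m, hm, hmn⟩ := exists_val_norm hext hinv hn
    rw [hw, hπ, WithTop.coe_inj] at hm
    rw [← hm, hdeg, Nat.cast_one, one_mul] at hmn
    have := Int.isUnit_iff.1 (IsUnit.of_mul_eq_one _ hmn.symm)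
    have := hℓ.two_le
    omega
  · obtain ⟨σ, hσ⟩ := exists_aut_ne_one hℓ hdeg
    obtain ⟨b, hb0, hb⟩ := exists_break hext hinv hϖ hdeg hσ
    rcases hb0.eq_or_lt with rfl | hb0
    · obtain ⟨a, ha, hua, ha1⟩ := exists_residue_break hℓ hext hinv hϖ hdeg σ
      have hinj := residue_injective_of_surjective (v := vA) (fun x => x ^ e)
        (fun x hx => hx.pow0 e) (fun x y hx hy hxy => levelGE_pow_sub_pow hx hy hxy e) (by
          intro r hr
          by_cases hr1 : LevelGE vA 1 r
          · refine ⟨0, LevelGE.zero 0, ?_⟩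
            simpa [hℓ.ne_zero] using hr1.neg
          have hr0 : vA r = ((0 : ℤ) : WithTop ℤ) := val_eq_iff.2 ⟨hr, hr1⟩
          obtain ⟨w, hw⟩ := exists_norm_eq_of_top htop (ne_zero_of_val hr0)
          have hw0 := levelGE_of_eq (val_eq_zero_of_norm hext hinv (hw ▸ hr0))
          obtain ⟨x, hx, hwx⟩ := exists_residue hℓ.pos hext hϖ hdeg hw0
          refine ⟨x, hx, ?_⟩
          have := levelGE_norm_sub_pow hext hinv hw0 hx hwx
          rw [hw, hdeg] at this
          exact this.sub_comm)
      have h1 := hinj a 1 ha LevelGE.one (by simpa using ha1)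
      have h2 := hext.levelGE_map_iff.2 h1
      rw [map_sub, map_one] at h2
      have h3 := hua.trans (h2.mono (m := 1) (by have := hℓ.pos; omega))
      rw [levelGE_iff hb] at h3
      omega
    · obtain ⟨z, hz, hzw⟩ := IsWild.exists_not_norm
        ⟨hℓ, hext, hinv, hϖ, hdeg, mem_zpowers_of_finrank_prime hℓ hdeg hσ, hℓ0, hb0, hb⟩
      obtain ⟨w, hw⟩ := exists_norm_eq_of_top htop (ne_zero_of_val (val_of_sub_one hb0 hz))
      refine hzw w ?_
      rw [hw, sub_self]
      exact LevelGE.zero _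

end PrimeDegree

section Tower

variable {A E M : Type*} [Field A] [Field E] [Field M] [Algebra A E] [Algebra E M] [Algebra A M]
  [IsScalarTower A E M] {vA : AddValuation A (WithTop ℤ)} {vE : AddValuation E (WithTop ℤ)}
  {vM : AddValuation M (WithTop ℤ)} {e : ℕ}

lemma nsmul_le_nsmul_withTop_iff {d : ℕ} (hd : 0 < d) {a b : WithTop ℤ} :
    d • a ≤ d • b ↔ a ≤ b := by
  have hd' : (0 : ℤ) < d := by exact_mod_cast hd
  have htop : d • (⊤ : WithTop ℤ) = ⊤ := by
    obtain ⟨m, rfl⟩ : ∃ m, d = m + 1 := ⟨d - 1, by omega⟩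
    rw [succ_nsmul, WithTop.add_top]
  induction a using WithTop.recTopCoe with
  | top =>
    induction b using WithTop.recTopCoe with
    | top => simp
    | coe b =>
      rw [htop, ← WithTop.coe_nsmul, top_le_iff, top_le_iff]
      exact iff_of_false (WithTop.coe_ne_top) (WithTop.coe_ne_top)
  | coe a =>
    induction b using WithTop.recTopCoe with
    | top => simp [htop]
    | coe b =>
      rw [← WithTop.coe_nsmul, ← WithTop.coe_nsmul, WithTop.coe_le_coe, WithTop.coe_le_coe,
        nsmul_eq_mul, nsmul_eq_mul, mul_le_mul_iff_right₀ hd']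

lemma nsmul_withTop_injective {d : ℕ} (hd : 0 < d) {a b : WithTop ℤ} (h : d • a = d • b) :
    a = b :=
  le_antisymm ((nsmul_le_nsmul_withTop_iff hd).1 h.le) ((nsmul_le_nsmul_withTop_iff hd).1 h.ge)

/-- The normalized valuation on an intermediate field. -/
lemma exists_intermediate_valuation (hvA : IsNormalized vA) (hext : Extends vA vM e) :
    ∃ (vE : AddValuation E (WithTop ℤ)) (e₁ e₂ : ℕ),
      IsNormalized vE ∧ Extends vA vE e₁ ∧ Extends vE vM e₂ := by
  let H : AddSubgroup ℤ :=
    { carrier := {n | ∃ x : E, vM (algebraMap E M x) = (n : WithTop ℤ)}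
      zero_mem' := ⟨1, by simp⟩
      add_mem' := by
        rintro a b ⟨x, hx⟩ ⟨y, hy⟩
        exact ⟨x * y, by rw [map_mul, val_mul hx hy]⟩
      neg_mem' := by
        rintro a ⟨x, hx⟩
        exact ⟨x⁻¹, by rw [map_inv₀, val_inv hx]⟩ }
  obtain ⟨π, hπ⟩ := hvA 1
  have heH : (e : ℤ) ∈ H := ⟨algebraMap A E π, by
    rw [← IsScalarTower.algebraMap_apply, hext.val_map hπ, mul_one]⟩
  obtain ⟨a, ha⟩ := Int.subgroup_cyclic H
  have hmem : ∀ n, n ∈ H ↔ a ∣ n := fun n => by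
    rw [ha, ← AddSubgroup.zmultiples_eq_closure, Int.mem_zmultiples_iff]
  have he : 0 < e := hext.1
  have hae := (hmem _).1 heH
  have hd : 0 < a.natAbs := Int.natAbs_pos.2 (by rintro rfl; simp at hae; omega)
  set d := a.natAbs with hdef
  have hmem' : ∀ n, n ∈ H ↔ (d : ℤ) ∣ n := fun n => by rw [hmem, hdef, Int.natAbs_dvd]
  have hf : ∀ x : E, ∃ b : WithTop ℤ, d • b = vM (algebraMap E M x) := by
    intro x
    by_cases hx : x = 0
    · refine ⟨⊤, ?_⟩
      obtain ⟨m, hm⟩ : ∃ m, d = m + 1 := ⟨d - 1, by omega⟩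
      rw [hx, map_zero, vM.map_zero, hm, succ_nsmul, WithTop.add_top]
    · obtain ⟨n, hn⟩ := exists_val (v := vM) (x := algebraMap E M x) (by simpa using hx)
      obtain ⟨k, hk⟩ := (hmem' n).1 ⟨x, hn⟩
      exact ⟨k, by rw [hn, hk, ← WithTop.coe_nsmul, nsmul_eq_mul]⟩
  choose f hf using hf
  refine ⟨AddValuation.of f ?_ ?_ ?_ ?_, e / d, d, ?_, ⟨?_, ?_⟩, hd, fun x => (hf x).symm⟩
  · refine nsmul_withTop_injective hd ?_
    obtain ⟨m, hm⟩ : ∃ m, d = m + 1 := ⟨d - 1, by omega⟩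
    rw [hf, map_zero, vM.map_zero, hm, succ_nsmul, WithTop.add_top]
  · refine nsmul_withTop_injective hd ?_
    rw [hf, map_one, vM.map_one, smul_zero]
  · intro x y
    rw [min_le_iff, ← nsmul_le_nsmul_withTop_iff hd, ← nsmul_le_nsmul_withTop_iff hd (a := f y),
      hf, hf, hf, ← min_le_iff, map_add]
    exact vM.map_add _ _
  · intro x y
    refine nsmul_withTop_injective hd ?_
    rw [smul_add, hf, hf, hf, map_mul, vM.map_mul]
  · intro n
    obtain ⟨x, hx⟩ := (hmem' (d * n)).2 ⟨n, rfl⟩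
    refine ⟨x, nsmul_withTop_injective hd ?_⟩
    rw [AddValuation.of_apply, hf, hx, ← WithTop.coe_nsmul, nsmul_eq_mul]
  · have := (hmem' _).1 heH
    exact Nat.div_pos (Nat.le_of_dvd he (by exact_mod_cast this)) hd
  · intro x
    refine nsmul_withTop_injective hd ?_
    have hde : d ∣ e := by exact_mod_cast (hmem' _).1 heH
    rw [AddValuation.of_apply, hf, ← IsScalarTower.algebraMap_apply, hext.2, smul_smul,
      Nat.mul_div_cancel' hde]

lemma GalInvariant.bot [Normal A E] [Normal A M] (hext : Extends vE vM e)
    (h : GalInvariant A vM) : GalInvariant A vE := by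
  intro σ x
  refine nsmul_withTop_injective hext.1 ?_
  rw [← hext.2, ← hext.2, ← AlgEquiv.liftNormal_commutes, h]

variable (E) in
lemma GalInvariant.top (h : GalInvariant A vM) : GalInvariant E vM := fun σ x =>
  h (σ.restrictScalars A) x

lemma Extends.finite_residues (p : ℕ) [Fact p.Prime] [Algebra ℚ_[p] A] [FiniteDimensional ℚ_[p] A]
    [FiniteDimensional A E] {eA : ℕ} (hvA : IsPadicValuation p vA eA) (hvE : IsNormalized vE)
    (hext : Extends vA vE e) : Finite (Residues vE) := by
  let _ : Algebra ℚ_[p] E := ((algebraMap A E).comp (algebraMap ℚ_[p] A)).toAlgebra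
  have : IsScalarTower ℚ_[p] A E := IsScalarTower.of_algebraMap_eq fun _ => rfl
  have : FiniteDimensional ℚ_[p] E := FiniteDimensional.trans ℚ_[p] A E
  have h : IsPadicValuation p vE (e * eA) := by
    refine ⟨hvE, Nat.mul_pos hext.1 hvA.2.1, fun x hx => ?_⟩
    rw [IsScalarTower.algebraMap_apply ℚ_[p] A E, hext.val_map (hvA.2.2 x hx)]
    push_cast
    rw [mul_assoc]
  exact h.finite_residues

end Tower

section AbelianExtension

lemma exists_subgroup_index_eq_prime {G : Type*} [CommGroup G] [Finite G] {ℓ : ℕ} (hℓ : ℓ.Prime)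
    (h : ℓ ∣ Nat.card G) : ∃ H : Subgroup G, H.index = ℓ := by
  have : Fact ℓ.Prime := ⟨hℓ⟩
  let R := (powMonoidHom ℓ : G →* G).range
  have hR : R ≠ ⊤ := by
    intro htop
    have hinj := Finite.injective_iff_surjective.2 (MonoidHom.range_eq_top.1 htop)
    obtain ⟨x, hx⟩ := exists_prime_orderOf_dvd_card' ℓ h
    have h1 : x = 1 := hinj (by simp [← hx, pow_orderOf_eq_one])
    rw [h1, orderOf_one] at hx
    exact hℓ.one_lt.ne hx
  have hQ : IsPGroup ℓ (G ⧸ R) := by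
    intro g
    induction g using QuotientGroup.induction_on with
    | H z =>
      refine ⟨1, ?_⟩
      rw [pow_one, ← QuotientGroup.mk_pow, QuotientGroup.eq_one_iff]
      exact ⟨z, rfl⟩
  obtain ⟨n, hn⟩ := IsPGroup.iff_card.1 hQ
  have hn0 : n ≠ 0 := by
    rintro rfl
    rw [pow_zero] at hn
    exact hR (Subgroup.index_eq_one.1 hn)
  obtain ⟨m, rfl⟩ := Nat.exists_eq_succ_of_ne_zero hn0
  obtain ⟨S, hS⟩ := Sylow.exists_subgroup_card_pow_prime (G := G ⧸ R) ℓ (n := m)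
    (hn ▸ pow_dvd_pow ℓ (Nat.le_succ m))
  refine ⟨S.comap (QuotientGroup.mk' R), ?_⟩
  rw [Subgroup.index_comap_of_surjective _ (QuotientGroup.mk'_surjective R)]
  have := S.card_mul_index
  rw [hn, hS, pow_succ] at this
  exact mul_left_cancel₀ (pow_ne_zero _ hℓ.ne_zero) this

variable {A M : Type*} [Field A] [Field M] [Algebra A M] [FiniteDimensional A M]

lemma normGroup_le (E : IntermediateField A M) : normGroup A M ≤ normGroup A E := by
  intro u hu
  obtain ⟨w, hw⟩ := mem_normGroup_iff.1 hu
  exact mem_normGroup_iff.2 ⟨Algebra.norm E w, by rw [Algebra.norm_norm, hw]⟩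

variable [IsGalois A M]

lemma exists_intermediateField_prime (hab : ∀ σ τ : M ≃ₐ[A] M, σ * τ = τ * σ) {ℓ : ℕ}
    (hℓ : ℓ.Prime) (h : ℓ ∣ Module.finrank A M) :
    ∃ E : IntermediateField A M, Module.finrank A E = ℓ ∧ IsGalois A E := by
  let _ : CommGroup (M ≃ₐ[A] M) := { (inferInstance : Group (M ≃ₐ[A] M)) with mul_comm := hab }
  rw [← IsGalois.card_aut_eq_finrank] at h
  obtain ⟨H, hH⟩ := exists_subgroup_index_eq_prime hℓ h
  refine ⟨IntermediateField.fixedField H, ?_, ?_⟩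
  · have h1 := Module.finrank_mul_finrank A (IntermediateField.fixedField H) M
    rw [IntermediateField.finrank_fixedField_eq_card, ← IsGalois.card_aut_eq_finrank A M,
      ← H.index_mul_card, hH] at h1
    exact mul_right_cancel₀ Nat.card_pos.ne' h1
  · have : H.Normal := H.normal_of_isMulCommutative
    exact IsGalois.of_fixedField_normal_subgroup H

theorem exists_intermediateField_normGroup_ne_top {vA : AddValuation A (WithTop ℤ)}
    {vM : AddValuation M (WithTop ℤ)} {ℓ e : ℕ}
    (hab : ∀ σ τ : M ≃ₐ[A] M, σ * τ = τ * σ) (hℓ : ℓ.Prime) (h : ℓ ∣ Module.finrank A M)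
    (hvA : IsNormalized vA) [Finite (Residues vA)] (hext : Extends vA vM e)
    (hinv : GalInvariant A vM) (hℓ0 : (ℓ : A) ≠ 0) :
    ∃ E : IntermediateField A M, Module.finrank A E = ℓ ∧ IsGalois A E ∧ normGroup A E ≠ ⊤ := by
  obtain ⟨E, hE, hGal⟩ := exists_intermediateField_prime hab hℓ h
  refine ⟨E, hE, hGal, ?_⟩
  obtain ⟨vE, e₁, e₂, hvE, h1, h2⟩ := exists_intermediate_valuation (E := E) hvA hext
  refine normGroup_ne_top_of_prime hℓ hvA hvE h1 (hinv.bot h2) hE ?_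
  rwa [← map_natCast (algebraMap A E), Ne, map_eq_zero]

end AbelianExtension

section HilbertNinety

variable {A E : Type*} [Field A] [Field E] [Algebra A E] [FiniteDimensional A E] [IsGalois A E]

/-- Hilbert's Theorem 90 for a cyclic extension with generator `σ`. -/
theorem exists_mul_aut_eq_of_norm_eq_one {σ : E ≃ₐ[A] E} (hσ : ∀ τ, τ ∈ Subgroup.zpowers σ)
    {η : E} (hη : Algebra.norm A η = 1) : ∃ y : E, y ≠ 0 ∧ η * σ y = y := by
  set n := orderOf σ with hn
  have hinj : Function.Injective fun i : Fin n => ((σ ^ (i : ℕ) : E ≃ₐ[A] E) : E →* E) := by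
    intro i j hij
    refine Fin.ext (pow_injOn_Iio_orderOf i.2 j.2 (AlgEquiv.ext fun x => ?_))
    exact DFunLike.congr_fun hij x
  have hli := (linearIndependent_monoidHom E E).comp _ hinj
  rw [Fintype.linearIndependent_iff] at hli
  have hη0 : η ≠ 0 := by
    rw [← Algebra.norm_ne_zero_iff (R := A), hη]
    exact one_ne_zero
  let c : ℕ → E := fun i => ∏ j ∈ Finset.range i, (σ ^ j) η
  have hc : ∀ i, η * σ (c i) = c (i + 1) := by
    intro i
    simp only [c]
    rw [Finset.prod_range_succ', map_prod, mul_comm]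
    simp only [pow_succ', AlgEquiv.mul_apply, pow_zero, AlgEquiv.one_apply]
  have hcn : c n = 1 := by
    have h1 := Algebra.norm_eq_prod_automorphisms A η
    rw [hη, map_one] at h1
    rw [h1]
    rw [← IsCyclic.image_range_orderOf hσ, Finset.prod_image]
    intro i hi j hj hij
    exact pow_injOn_Iio_orderOf (by simpa using hi) (by simpa using hj) hij
  obtain ⟨z, hz⟩ : ∃ z, ∑ i : Fin n, c i * (σ ^ (i : ℕ)) z ≠ 0 := by
    by_contra! hcon
    have hpos : 0 < n := orderOf_pos σ
    have := hli (fun i => c i) (by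
      ext z
      simpa using hcon z) ⟨0, hpos⟩
    simp [c] at this
  refine ⟨_, hz, ?_⟩
  rw [Fin.sum_univ_eq_sum_range (fun i => c i * (σ ^ i) z)]
  have hstep : ∀ i, η * σ (c i * (σ ^ i) z) = c (i + 1) * (σ ^ (i + 1)) z := by
    intro i
    rw [map_mul, ← mul_assoc, hc, pow_succ', AlgEquiv.mul_apply]
  rw [map_sum, Finset.mul_sum, Finset.sum_congr rfl fun i _ => hstep i]
  have h1 := Finset.sum_range_succ (fun i => c i * (σ ^ i) z) n
  have h2 := Finset.sum_range_succ' (fun i => c i * (σ ^ i) z) n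
  rw [h2, hcn, hn, pow_orderOf_eq_one] at h1
  simpa [c] using h1

end HilbertNinety

section Chain

lemma eq_zero_of_surjective_sub_one {Q : Type*} [AddCommGroup Q] {ℓ k : ℕ} (hℓ : ℓ.Prime)
    {s : AddMonoid.End Q} (hs : s ^ ℓ = 1) (hsurj : ∀ q, ∃ r, s r - r = q)
    (hk : ∀ q : Q, ℓ ^ k • q = 0) (q : Q) : q = 0 := by
  obtain ⟨r, hr⟩ := (Commute.one_right (s - 1)).exists_add_pow_prime_eq hℓ
  rw [sub_add_cancel, hs, one_pow] at hr
  have hpow : ∀ n : ℕ, ∀ q, ∃ r, ((s - 1) ^ n) r = q := by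
    intro n
    induction n with
    | zero => exact fun q => ⟨q, rfl⟩
    | succ n ih =>
      intro q
      obtain ⟨q₁, hq₁⟩ := hsurj q
      obtain ⟨q₂, hq₂⟩ := ih q₁
      refine ⟨q₂, ?_⟩
      rw [pow_succ']
      change s (((s - 1) ^ n) q₂) - ((s - 1) ^ n) q₂ = q
      rw [hq₂, hq₁]
  have hdiv : ∀ q, ∃ r : Q, ℓ • r = q := by
    intro q
    obtain ⟨q', hq'⟩ := hpow ℓ q
    refine ⟨-((s - 1) * 1 * r) q', ?_⟩
    have h1 : (s - 1) ^ ℓ = -((ℓ : AddMonoid.End Q) * ((s - 1) * 1 * r)) := by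
      rw [eq_neg_iff_add_eq_zero]
      have : (1 : AddMonoid.End Q) = (s - 1) ^ ℓ + ℓ * ((s - 1) * 1 * r) + 1 := by
        conv_lhs => rw [hr]
        simp only [mul_assoc]
        abel
      simpa using this.symm
    rw [← hq', h1, smul_neg]
    rfl
  have hdivk : ∀ n : ℕ, ∀ q, ∃ r : Q, ℓ ^ n • r = q := by
    intro n
    induction n with
    | zero => exact fun q => ⟨q, by simp⟩
    | succ n ih =>
      intro q
      obtain ⟨q₁, hq₁⟩ := hdiv q
      obtain ⟨q₂, hq₂⟩ := ih q₁
      exact ⟨q₂, by rw [pow_succ', mul_smul, hq₂, hq₁]⟩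
  obtain ⟨r, rfl⟩ := hdivk k q
  exact hk r

variable {A E M : Type*} [Field A] [Field E] [Field M] [Algebra A E] [Algebra E M] [Algebra A M]
  [IsScalarTower A E M] [FiniteDimensional A E] [IsGalois A E] [FiniteDimensional E M]
  [Normal A M]

/-- If the norm group of `M/E` is proper, `E/A` has prime degree `ℓ` and `[M : E]` is a power
of `ℓ`, then `M` and `E` have different norm groups over `A`. -/
theorem normGroup_ne_of_chain {ℓ k : ℕ} (hℓ : ℓ.Prime) (hdeg : Module.finrank A E = ℓ)
    (hk : Module.finrank E M = ℓ ^ k) (hne : normGroup E M ≠ ⊤) :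
    normGroup A M ≠ normGroup A E := by
  intro heq
  have : FiniteDimensional A M := FiniteDimensional.trans A E M
  obtain ⟨σ, hσ⟩ := exists_aut_ne_one hℓ hdeg
  have hgen := mem_zpowers_of_finrank_prime hℓ hdeg hσ
  set H := normGroup E M
  let f : Eˣ →* Eˣ := Units.map (σ : E →* E)
  have hf : H ≤ H.comap f := by
    intro u hu
    obtain ⟨w, hw⟩ := mem_normGroup_iff.1 hu
    refine mem_normGroup_iff.2 ⟨σ.liftNormal M w, ?_⟩
    have := Algebra.norm_eq_of_equiv_equiv σ.toRingEquiv (σ.liftNormal M).toRingEquiv (by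
      ext x
      exact (σ.liftNormal_commutes M x).symm) w
    rw [hw] at this
    change _ = σ u
    rw [this]
    exact (σ.apply_symm_apply _).symm
  let s : AddMonoid.End (Additive (Eˣ ⧸ H)) := (QuotientGroup.map H H f hf).toAdditive
  have hmk : ∀ q : Additive (Eˣ ⧸ H), ∃ x : Eˣ, q = Additive.ofMul (x : Eˣ ⧸ H) := fun q =>
    ⟨_, congrArg Additive.ofMul (QuotientGroup.out_eq' q.toMul).symm⟩
  have hsx : ∀ x : Eˣ, s (Additive.ofMul (x : Eˣ ⧸ H)) = Additive.ofMul ((f x : Eˣ) : Eˣ ⧸ H) :=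
    fun x => rfl
  have hs : s ^ ℓ = 1 := by
    have hσℓ : σ ^ ℓ = 1 := by
      rw [← hdeg, ← IsGalois.card_aut_eq_finrank]
      exact pow_card_eq_one'
    have hiter : ∀ n : ℕ, ∀ x : Eˣ, (s ^ n) (Additive.ofMul (x : Eˣ ⧸ H)) =
        Additive.ofMul ((Units.map ((σ ^ n : E ≃ₐ[A] E) : E →* E) x : Eˣ) : Eˣ ⧸ H) := by
      intro n x
      induction n with
      | zero => rfl
      | succ n ih =>
        rw [pow_succ', pow_succ']
        change s ((s ^ n) _) = _
        rw [ih, hsx]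
        rfl
    ext q
    obtain ⟨x, rfl⟩ := hmk q
    rw [hiter, hσℓ]
    rfl
  refine hne (top_unique fun x _ => ?_)
  have h0 := eq_zero_of_surjective_sub_one (k := k) hℓ hs (fun q => ?_) (fun q => ?_)
    (Additive.ofMul (x : Eˣ ⧸ H))
  · exact (QuotientGroup.eq_one_iff x).1 (Additive.ofMul.injective h0)
  · obtain ⟨x, rfl⟩ := hmk q
    have hx : Units.map (Algebra.norm A : E →* A) x ∈ normGroup A M := by
      rw [heq]
      exact ⟨x, rfl⟩
    obtain ⟨w, hw⟩ := hx
    have hw' : Algebra.norm A (w : M) = Algebra.norm A (x : E) := congrArg Units.val hw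
    let h : Eˣ := Units.map (Algebra.norm E : M →* E) w
    have hh : h ∈ H := ⟨w, rfl⟩
    have hN : Algebra.norm A ((x / h : Eˣ) : E) = 1 := by
      rw [Units.val_div_eq_div_val, algebraNorm_div h.ne_zero]
      change _ / Algebra.norm A (Algebra.norm E (w : M)) = 1
      rw [Algebra.norm_norm, hw', div_self (Algebra.norm_ne_zero_iff.2 x.ne_zero)]
    obtain ⟨y, hy0, hy⟩ := exists_mul_aut_eq_of_norm_eq_one hgen hN
    let y' : Eˣ := Units.mk0 y hy0
    have hxy : x / h * f y' = y' := Units.ext hy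
    refine ⟨Additive.ofMul ((y'⁻¹ : Eˣ) : Eˣ ⧸ H), ?_⟩
    rw [hsx, ← ofMul_div, ← QuotientGroup.mk_div]
    refine congrArg Additive.ofMul (QuotientGroup.eq.2 ?_)
    have : (f y'⁻¹ / y'⁻¹)⁻¹ * x = h := by
      rw [div_mul_eq_mul_div, div_eq_iff_eq_mul] at hxy
      simp only [map_inv, div_inv_eq_mul, mul_inv_rev, inv_inv]
      rw [mul_assoc, inv_mul_eq_iff_eq_mul, mul_comm (f y'), hxy]
    rwa [this]
  · obtain ⟨x, rfl⟩ := hmk q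
    rw [← ofMul_pow, ← QuotientGroup.mk_pow]
    refine congrArg Additive.ofMul ((QuotientGroup.eq_one_iff _).2 ?_)
    refine mem_normGroup_iff.2 ⟨algebraMap E M x, ?_⟩
    rw [Algebra.norm_algebraMap, hk, Units.val_pow_eq_pow_val]

end Chain

/-- The prime `p` has valuation `(p - 1) * r`; this holds when the field contains the `p`-th roots
of unity. -/
structure HasRootLevel {E : Type*} [Field E] (v : AddValuation E (WithTop ℤ)) (p r : ℕ) :
    Prop where
  prime : p.Prime
  pos : 1 ≤ r
  val_prime : v (p : E) = (((p - 1) * r : ℤ) : WithTop ℤ)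

/-- The map describing `p`-th powers on the critical step `U^r/U^(r+1) → U^(pr)/U^(pr+1)`. -/
def criticalMap {E : Type*} [Field E] (p : ℕ) (ω : E) (z : E) : E :=
  z ^ p + (p : E) / ω ^ (p - 1) * z

namespace HasRootLevel

variable {E : Type*} [Field E] {v : AddValuation E (WithTop ℤ)} {p r : ℕ}

lemma levelGE_one (h : HasRootLevel v p r) : LevelGE v 1 (p : E) := by
  rw [levelGE_iff h.val_prime]
  have h1 : (2 : ℤ) ≤ p := by exact_mod_cast h.prime.two_le
  have h2 : (1 : ℤ) ≤ r := by exact_mod_cast h.pos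
  nlinarith

lemma ne_zero (h : HasRootLevel v p r) : (p : E) ≠ 0 := ne_zero_of_val h.val_prime

lemma levelGE_pow_sub_sub (h : HasRootLevel v p r) {n : ℤ} (hn : 0 ≤ n) {y : E}
    (hy : LevelGE v n y) : LevelGE v ((p - 1) * r + n) ((1 + y) ^ p - 1 - y ^ p) := by
  obtain ⟨s, hs, heq⟩ := exists_one_add_pow_eq h.prime (hy.mono hn)
  have : (1 + y) ^ p - 1 - y ^ p = p * y * (1 + y * s) := by rw [heq]; ring
  rw [this]
  refine ((levelGE_of_eq h.val_prime).mul hy).mul' (n := 0) ?_ (by omega)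
  exact LevelGE.one.add ((hy.mono hn).mul' hs (by omega))

lemma levelGE_pow_sub_linear (h : HasRootLevel v p r) {n : ℤ} (hn : r < n) {y : E}
    (hy : LevelGE v n y) : LevelGE v ((p - 1) * r + n + 1) ((1 + y) ^ p - 1 - p * y) := by
  have h1 : (2 : ℤ) ≤ p := by exact_mod_cast h.prime.two_le
  have h2 : (1 : ℤ) ≤ r := by exact_mod_cast h.pos
  obtain ⟨s, hs, heq⟩ := exists_one_add_pow_eq h.prime (hy.mono (by omega))
  have : (1 + y) ^ p - 1 - p * y = y ^ p + p * y * (y * s) := by rw [heq]; ring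
  rw [this]
  refine LevelGE.add ((hy.pow p).mono (by nlinarith)) ?_
  exact ((levelGE_of_eq h.val_prime).mul hy).mul' (hy.mul hs) (by omega)

lemma levelGE_pow_sub_critical (h : HasRootLevel v p r) {y : E}
    (hy : LevelGE v r y) : LevelGE v (p * r + 1) ((1 + y) ^ p - 1 - (y ^ p + p * y)) := by
  have h2 : (1 : ℤ) ≤ r := by exact_mod_cast h.pos
  obtain ⟨s, hs, heq⟩ := exists_one_add_pow_eq h.prime (hy.mono (by omega))
  have : (1 + y) ^ p - 1 - (y ^ p + p * y) = p * y * (y * s) := by rw [heq]; ring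
  rw [this]
  exact ((levelGE_of_eq h.val_prime).mul hy).mul' (hy.mul hs) (by linarith)

lemma levelGE_pow_sub_one (h : HasRootLevel v p r) {y : E} (hy : LevelGE v r y) :
    LevelGE v (p * r) ((1 + y) ^ p - 1) := by
  have h1 := (h.levelGE_pow_sub_sub (by omega) hy).add ((hy.pow p).mono (by linarith))
  rw [sub_add_cancel] at h1
  exact h1.mono (by linarith)

lemma val_pow_sub_one (h : HasRootLevel v p r) {n : ℤ} (hn : 1 ≤ n) (hnr : n < r) {y : E}
    (hy : v y = (n : WithTop ℤ)) : v ((1 + y) ^ p - 1) = ((p * n : ℤ) : WithTop ℤ) := by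
  have h1 : (2 : ℤ) ≤ p := by exact_mod_cast h.prime.two_le
  exact val_eq_of_sub (val_pow hy p)
    ((h.levelGE_pow_sub_sub (by omega) (levelGE_of_eq hy)).mono (by nlinarith))

lemma val_pow_sub_one_or (h : HasRootLevel v p r) {y : E} (hy : LevelGE v 1 y) :
    (∃ n : ℤ, 1 ≤ n ∧ n < r ∧ v ((1 + y) ^ p - 1) = ((p * n : ℤ) : WithTop ℤ)) ∨
      LevelGE v r y := by
  by_cases hr : LevelGE v r y
  · exact Or.inr hr
  obtain ⟨n, hn⟩ := exists_val (v := v) (ne_zero_of_not_levelGE hr)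
  rw [levelGE_iff hn] at hy hr
  exact Or.inl ⟨n, hy, not_le.1 hr, h.val_pow_sub_one hy (not_le.1 hr) hn⟩

variable {ω : E}

lemma levelGE_coeff (h : HasRootLevel v p r) (hω : v ω = ((r : ℤ) : WithTop ℤ)) :
    LevelGE v 0 ((p : E) / ω ^ (p - 1)) := by
  refine LevelGE.inv_mul (val_pow hω (p - 1)) (levelGE_of_eq h.val_prime) ?_
  rw [Nat.cast_sub h.prime.one_lt.le]
  simp

lemma levelGE_criticalMap (h : HasRootLevel v p r) (hω : v ω = ((r : ℤ) : WithTop ℤ)) {z : E}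
    (hz : LevelGE v 0 z) : LevelGE v 0 (criticalMap p ω z) :=
  (hz.pow0 p).add ((h.levelGE_coeff hω).mul' hz (by omega))

lemma levelGE_criticalMap_sub (h : HasRootLevel v p r) (hω : v ω = ((r : ℤ) : WithTop ℤ))
    {x y : E} (hx : LevelGE v 0 x) (hy : LevelGE v 0 y) (hxy : LevelGE v 1 (x - y)) :
    LevelGE v 1 (criticalMap p ω x - criticalMap p ω y) := by
  have : criticalMap p ω x - criticalMap p ω y =
      (x ^ p - y ^ p) + (p : E) / ω ^ (p - 1) * (x - y) := by
    simp only [criticalMap]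
    ring
  rw [this]
  exact (levelGE_pow_sub_pow hx hy hxy p).add ((h.levelGE_coeff hω).mul' hxy (by omega))

lemma levelGE_pow_sub_criticalMap (h : HasRootLevel v p r) (hω : v ω = ((r : ℤ) : WithTop ℤ))
    {z : E} (hz : LevelGE v 0 z) :
    LevelGE v (p * r + 1) ((1 + z * ω) ^ p - 1 - ω ^ p * criticalMap p ω z) := by
  have h1 := h.levelGE_pow_sub_critical (hz.mul' (levelGE_of_eq hω) (k := r) (by omega))
  convert h1 using 2
  have hω0 := ne_zero_of_val hω
  have hsplit : ω ^ p = ω ^ (p - 1) * ω := (pow_sub_one_mul h.prime.ne_zero ω).symm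
  have hlin : ω ^ p * ((p : E) / ω ^ (p - 1) * z) = p * (z * ω) := by
    rw [hsplit]
    field_simp
  rw [criticalMap, mul_add, hlin]
  ring

/-- `U^(t+1)` consists of `p`-th powers, `t = pr`. -/
lemma exists_pow_eq (h : HasRootLevel v p r)
    (hlarge : ∃ m : ℕ, ∀ x : E, LevelGE v m (x - 1) → ∃ w : E, w ^ p = x) {x : E}
    (hx : LevelGE v (p * r + 1) (x - 1)) : ∃ w : E, w ^ p = x := by
  obtain ⟨m, hm⟩ := hlarge
  have h2 : (1 : ℤ) ≤ r := by exact_mod_cast h.pos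
  have key : ∀ k : ℕ, ∀ n : ℤ, p * r + 1 ≤ n → m ≤ n + k → ∀ x : E, LevelGE v n (x - 1) →
      ∃ w : E, w ^ p = x := by
    intro k
    induction k with
    | zero => exact fun n _ hmn x hx => hm x (hx.mono (by simpa using hmn))
    | succ k ih =>
      intro n hn hmn x hx
      have hn' : (p : ℤ) * r = (p - 1) * r + r := by ring
      have hy : LevelGE v (n - (p - 1) * r) ((x - 1) / p) :=
        LevelGE.inv_mul h.val_prime hx le_rfl
      have h3 := h.levelGE_pow_sub_linear (by omega) hy
      rw [mul_div_cancel₀ _ h.ne_zero] at h3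
      have h4 : LevelGE v (n + 1) (x - (1 + (x - 1) / p) ^ p) := by
        convert (h3.mono (m := n + 1) (by omega)).neg using 1
        ring
      have h5 : v ((1 + (x - 1) / p) ^ p) = ((0 : ℤ) : WithTop ℤ) := by
        have : v (1 + (x - 1) / p) = ((0 : ℤ) : WithTop ℤ) :=
          val_of_sub_one (n := 1) le_rfl (by
            rw [add_sub_cancel_left]
            exact hy.mono (by omega))
        simpa using val_pow this p
      obtain ⟨w, hw⟩ := ih (n + 1) (by omega) (by push_cast at hmn; omega) _ (h4.div_sub_one' h5)
      refine ⟨w * (1 + (x - 1) / p), ?_⟩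
      rw [mul_pow, hw, div_mul_cancel₀ _ (ne_zero_of_val h5)]
  refine key m _ le_rfl ?_ x hx
  have : (0 : ℤ) ≤ p * r := by positivity
  omega

/-- The `p`-th powers on the critical level are controlled by `criticalMap`. -/
lemma exists_criticalMap_of_pow (h : HasRootLevel v p r) (hω : v ω = ((r : ℤ) : WithTop ℤ))
    {a w : E} (ha : LevelGE v 0 a) (hw : w ^ p = 1 + ω ^ p * a) :
    ∃ z, LevelGE v 0 z ∧ LevelGE v 1 (criticalMap p ω z - a) := by
  have h2 : (1 : ℤ) ≤ r := by exact_mod_cast h.pos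
  have hp1 : (2 : ℤ) ≤ p := by exact_mod_cast h.prime.two_le
  have hωa : LevelGE v (p * r) (w ^ p - 1) := by
    rw [hw, add_sub_cancel_left]
    exact (levelGE_of_eq (val_pow hω p)).mul' ha (by omega)
  have hwp : v (w ^ p) = ((0 : ℤ) : WithTop ℤ) := val_of_sub_one (n := p * r) (by nlinarith) hωa
  have hw0 : LevelGE v 0 w := by
    have hw00 : w ≠ 0 := by
      rintro rfl
      rw [zero_pow h.prime.ne_zero] at hwp
      simp at hwp
    obtain ⟨n, hn⟩ := exists_val (v := v) hw00
    rw [val_pow hn, WithTop.coe_inj] at hwp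
    rw [levelGE_iff hn]
    rcases mul_eq_zero.1 hwp with h | h <;> omega
  have hw1 : LevelGE v 1 (w - 1) := by
    refine levelGE_sub_of_pow_sub h.prime h.levelGE_one hw0 LevelGE.one ?_
    rw [one_pow]
    exact hωa.mono (by nlinarith)
  have hwr : LevelGE v r (w - 1) := by
    rcases h.val_pow_sub_one_or hw1 with ⟨n, hn1, hnr, hv⟩ | hr
    · rw [add_sub_cancel] at hv
      rw [levelGE_iff hv] at hωa
      nlinarith
    · exact hr
  have hω0 := ne_zero_of_val hω
  have hz : LevelGE v 0 ((w - 1) / ω) := LevelGE.inv_mul hω hwr (by omega)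
  refine ⟨(w - 1) / ω, hz, ?_⟩
  have h3 := h.levelGE_pow_sub_criticalMap hω hz
  rw [div_mul_cancel₀ _ hω0, add_sub_cancel, hw, add_sub_cancel_left, ← mul_sub] at h3
  have h4 := LevelGE.inv_mul (val_pow hω p) h3 (k := 1) (by omega)
  rw [mul_div_cancel_left₀ _ (pow_ne_zero p hω0)] at h4
  exact h4.sub_comm

/-- A primitive `p`-th root of unity makes `criticalMap` non-surjective on residues. -/
lemma exists_not_criticalMap (h : HasRootLevel v p r) [Finite (Residues v)]
    (hω : v ω = ((r : ℤ) : WithTop ℤ)) {ζ : E} (hζ : IsPrimitiveRoot ζ p) :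
    ∃ a, LevelGE v 0 a ∧ ∀ z, LevelGE v 0 z → ¬ LevelGE v 1 (criticalMap p ω z - a) := by
  by_contra! hcon
  have h2 : (1 : ℤ) ≤ r := by exact_mod_cast h.pos
  have hω0 := ne_zero_of_val hω
  have hinj := residue_injective_of_surjective (criticalMap p ω)
    (fun x hx => h.levelGE_criticalMap hω hx)
    (fun x y hx hy hxy => h.levelGE_criticalMap_sub hω hx hy hxy) hcon
  have hζ1 : ζ - 1 ≠ 0 := sub_ne_zero.2 (hζ.ne_one h.prime.one_lt)
  have hζ0 : v ζ = ((0 : ℤ) : WithTop ℤ) := by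
    obtain ⟨n, hn⟩ := exists_val (v := v) (hζ.ne_zero h.prime.ne_zero)
    have := val_pow hn p
    rw [hζ.pow_eq_one, val_one, WithTop.coe_inj] at this
    rcases mul_eq_zero.1 this.symm with h' | h'
    · exact absurd (by exact_mod_cast h') h.prime.ne_zero
    · rw [hn, h']
  have hw1 : LevelGE v 1 (ζ - 1) := by
    refine levelGE_sub_of_pow_sub h.prime h.levelGE_one (levelGE_of_eq hζ0) LevelGE.one ?_
    rw [one_pow, hζ.pow_eq_one, sub_self]
    exact LevelGE.zero 1
  have hwr : LevelGE v r (ζ - 1) := by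
    rcases h.val_pow_sub_one_or hw1 with ⟨n, -, -, hv⟩ | hr
    · rw [add_sub_cancel, hζ.pow_eq_one, sub_self] at hv
      exact absurd rfl (ne_zero_of_val hv)
    · exact hr
  obtain ⟨n, hn⟩ := exists_val (v := v) hζ1
  have hz : LevelGE v 0 ((ζ - 1) / ω) := LevelGE.inv_mul hω hwr (by omega)
  have h3 := h.levelGE_pow_sub_criticalMap hω hz
  rw [div_mul_cancel₀ _ hω0, add_sub_cancel, hζ.pow_eq_one, sub_self, zero_sub] at h3
  have h4 := (LevelGE.inv_mul (val_pow hω p) h3.neg (k := 1) (by omega))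
  rw [neg_neg, mul_div_cancel_left₀ _ (pow_ne_zero p hω0)] at h4
  have h5 := hinj _ 0 hz (LevelGE.zero 0) (by simpa [criticalMap, h.prime.ne_zero] using h4)
  rw [sub_zero, levelGE_iff (val_div hn hω)] at h5
  have h6 := h.levelGE_pow_sub_linear (by omega) (levelGE_of_eq hn)
  rw [add_sub_cancel, hζ.pow_eq_one, sub_self, zero_sub] at h6
  have h7 := h6.neg
  rw [neg_neg, levelGE_iff (val_mul h.val_prime hn)] at h7
  omega

end HasRootLevel

section ResidueRing

variable {E : Type*} [Field E] {v : AddValuation E (WithTop ℤ)}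

/-- The valuation ring of `v`. -/
def integers (v : AddValuation E (WithTop ℤ)) : Subring E where
  carrier := {x | LevelGE v 0 x}
  mul_mem' hx hy := hx.mul' hy (by omega)
  one_mem' := LevelGE.one
  add_mem' hx hy := hx.add hy
  zero_mem' := LevelGE.zero 0
  neg_mem' hx := hx.neg

/-- The maximal ideal of the valuation ring of `v`. -/
def maximalIdeal (v : AddValuation E (WithTop ℤ)) : Ideal (integers v) where
  carrier := {x | LevelGE v 1 x.1}
  add_mem' hx hy := hx.add hy
  zero_mem' := LevelGE.zero 1
  smul_mem' a _ hx := a.2.mul' hx (by omega)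

lemma mem_maximalIdeal {x : integers v} : x ∈ maximalIdeal v ↔ LevelGE v 1 x.1 := Iff.rfl

/-- The residue ring of `v`. -/
abbrev ResidueRing (v : AddValuation E (WithTop ℤ)) := integers v ⧸ maximalIdeal v

instance : (maximalIdeal v).IsPrime := by
  refine ⟨fun h => ?_, fun {x y} hxy => ?_⟩
  · have h1 : (1 : integers v) ∈ maximalIdeal v := h ▸ Submodule.mem_top
    have := (levelGE_iff (val_one (v := v))).1 h1
    omega
  · rw [mem_maximalIdeal] at *
    by_contra! hcon
    obtain ⟨m, hm⟩ := exists_val (v := v) (ne_zero_of_not_levelGE hcon.1)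
    obtain ⟨n, hn⟩ := exists_val (v := v) (ne_zero_of_not_levelGE hcon.2)
    rw [levelGE_iff hm, mem_maximalIdeal, levelGE_iff hn] at hcon
    rw [show (x * y).1 = x.1 * y.1 from rfl, levelGE_iff (val_mul hm hn)] at hxy
    omega

instance [Finite (Residues v)] : Finite (ResidueRing v) := by
  refine Finite.of_surjective
    (Quotient.lift (s := residueSetoid v)
      (fun x : {x : E // LevelGE v 0 x} => Ideal.Quotient.mk (maximalIdeal v) x)
      fun a b (hab : LevelGE v 1 (a.1 - b.1)) => Ideal.Quotient.eq.2 hab) fun q => ?_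
  obtain ⟨x, rfl⟩ := Ideal.Quotient.mk_surjective q
  exact ⟨Quotient.mk (residueSetoid v) x, rfl⟩

end ResidueRing

section Index

/-- In characteristic `p`, the additive map `z ↦ z ^ p + c * z` of a finite domain has image of
index at most `p`. -/
lemma index_range_pow_add_le {k : Type*} [CommRing k] [IsDomain k] [Finite k] {p : ℕ}
    (hp : 2 ≤ p) (c : k) (f : k →+ k) (hf : ∀ z, f z = z ^ p + c * z) :
    f.range.index ≤ p := by
  rw [AddSubgroup.index_range]
  let P : Polynomial k := Polynomial.X ^ p + Polynomial.C c * Polynomial.X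
  have hdeg : (Polynomial.C c * Polynomial.X).degree < (p : WithBot ℕ) :=
    lt_of_le_of_lt (Polynomial.degree_C_mul_X_le c) (by exact_mod_cast hp)
  have hP : P.Monic := Polynomial.monic_X_pow_add hdeg
  have hPdeg : P.natDegree = p := by
    refine Polynomial.natDegree_eq_of_degree_eq_some ?_
    rw [Polynomial.degree_add_eq_left_of_degree_lt (by rwa [Polynomial.degree_X_pow]),
      Polynomial.degree_X_pow]
  have hsub : (f.ker : Set k) ⊆ P.roots.toFinset := by
    intro z hz
    have : z ^ p + c * z = 0 := by rw [← hf]; exact hz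
    simp [P, hP.ne_zero, Polynomial.mem_roots', this]
  calc Nat.card f.ker = (f.ker : Set k).ncard := rfl
    _ ≤ (P.roots.toFinset : Set k).ncard := Set.ncard_le_ncard hsub (Finset.finite_toSet _)
    _ = P.roots.toFinset.card := Set.ncard_coe_finset _
    _ ≤ Multiset.card P.roots := Multiset.toFinset_card_le _
    _ ≤ P.natDegree := Polynomial.card_roots' P
    _ = p := hPdeg

namespace HasRootLevel

variable {E : Type*} [Field E] {v : AddValuation E (WithTop ℤ)} {p r : ℕ} {ω : E}

lemma val_one_add (h : HasRootLevel v p r) (hω : v ω = ((r : ℤ) : WithTop ℤ)) {a : E}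
    (ha : LevelGE v 0 a) : LevelGE v (p * r) (1 + ω ^ p * a - 1) ∧
      v (1 + ω ^ p * a) = ((0 : ℤ) : WithTop ℤ) := by
  have h1 : (2 : ℤ) ≤ p := by exact_mod_cast h.prime.two_le
  have h2 : (1 : ℤ) ≤ r := by exact_mod_cast h.pos
  have h3 : LevelGE v (p * r) (1 + ω ^ p * a - 1) := by
    rw [add_sub_cancel_left]
    exact (levelGE_of_eq (val_pow hω p)).mul' ha (by omega)
  exact ⟨h3, val_of_sub_one (by nlinarith) h3⟩

/-- Units on the critical level which differ by a value of `criticalMap` agree up to `p`-th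
powers. -/
lemma exists_eq_mul_pow (h : HasRootLevel v p r)
    (hlarge : ∃ m : ℕ, ∀ x : E, LevelGE v m (x - 1) → ∃ w : E, w ^ p = x)
    (hω : v ω = ((r : ℤ) : WithTop ℤ)) {a b z : E} (ha : LevelGE v 0 a) (hb : LevelGE v 0 b)
    (hz : LevelGE v 0 z) (hab : LevelGE v 1 (criticalMap p ω z - (a - b))) :
    ∃ w, 1 + ω ^ p * a = (1 + ω ^ p * b) * w ^ p := by
  have h1 : (2 : ℤ) ≤ p := by exact_mod_cast h.prime.two_le
  have h2 : (1 : ℤ) ≤ r := by exact_mod_cast h.pos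
  have hpr : (1 : ℤ) ≤ p * r := by nlinarith
  have hωp := levelGE_of_eq (val_pow hω p)
  have h3 := h.levelGE_pow_sub_criticalMap hω hz
  have h4 : LevelGE v (p * r + 1) ((1 + z * ω) ^ p - 1 - ω ^ p * (a - b)) := by
    convert h3.add (hωp.mul' hab (k := p * r + 1) (by omega)) using 1
    ring
  have hb0 := (h.val_one_add hω hb).2
  have h5 : LevelGE v (p * r + 1) ((1 + ω ^ p * b) * (1 + z * ω) ^ p - (1 + ω ^ p * a)) := by
    have h6 : LevelGE v (p * r + 1) (ω ^ p * b * (ω ^ p * (a - b))) :=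
      (hωp.mul' hb (k := p * r) (by omega)).mul' (hωp.mul' (ha.sub hb) (k := p * r) (by omega))
        (by omega)
    convert ((levelGE_of_eq hb0).mul' h4 (k := p * r + 1) (by omega)).add h6 using 1
    ring
  have hz0 : v (1 + z * ω) = ((0 : ℤ) : WithTop ℤ) := val_of_sub_one (n := r) h2 (by
    rw [add_sub_cancel_left]
    exact hz.mul' (levelGE_of_eq hω) (by omega))
  have h7 : v ((1 + ω ^ p * b) * (1 + z * ω) ^ p) = ((0 : ℤ) : WithTop ℤ) := by
    simpa using val_mul hb0 (val_pow hz0 p)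
  obtain ⟨w, hw⟩ := h.exists_pow_eq hlarge (h5.sub_comm.div_sub_one' h7)
  refine ⟨(1 + z * ω) * w, ?_⟩
  rw [mul_pow, hw, ← mul_assoc, mul_div_cancel₀ _ (ne_zero_of_val h7)]

/-- A subgroup containing the `p`-th powers and meeting every class modulo the units of level
`pr` has index at most `p`. -/
lemma index_le (h : HasRootLevel v p r) [Finite (Residues v)]
    (hlarge : ∃ m : ℕ, ∀ x : E, LevelGE v m (x - 1) → ∃ w : E, w ^ p = x)
    (hω : v ω = ((r : ℤ) : WithTop ℤ)) {N : Subgroup Eˣ} (hN : ∀ w : Eˣ, w ^ p ∈ N)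
    (hrep : ∀ x : Eˣ, ∃ g ∈ N, LevelGE v (p * r) ((x : E) / g - 1)) :
    N.index ≠ 0 ∧ N.index ≤ p := by
  have : Fact p.Prime := ⟨h.prime⟩
  have hchar : CharP (ResidueRing v) p := by
    refine (CharP.charP_iff_prime_eq_zero h.prime).2 ?_
    have : ((p : integers v) : E) = (p : E) := by simp
    rw [← map_natCast (Ideal.Quotient.mk (maximalIdeal v)), Ideal.Quotient.eq_zero_iff_mem,
      mem_maximalIdeal, this]
    exact h.levelGE_one
  let c : ResidueRing v := Ideal.Quotient.mk _ ⟨_, h.levelGE_coeff hω⟩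
  let f : ResidueRing v →+ ResidueRing v :=
    { toFun := fun z => z ^ p + c * z
      map_zero' := by simp [h.prime.ne_zero]
      map_add' := fun x y => by rw [add_pow_char]; ring }
  have hf : f.range.index ≤ p := index_range_pow_add_le h.prime.two_le c f fun _ => rfl
  have hex : ∀ q : Eˣ ⧸ N, ∃ a : integers v, ∃ x : Eˣ, (QuotientGroup.mk x : Eˣ ⧸ N) = q ∧
      (x : E) = 1 + ω ^ p * a := by
    intro q
    obtain ⟨x, rfl⟩ := QuotientGroup.mk_surjective q
    obtain ⟨g, hg, hx⟩ := hrep x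
    refine ⟨⟨((x : E) / g - 1) / ω ^ p, LevelGE.inv_mul (val_pow hω p) hx (by omega)⟩,
      x / g, ?_, ?_⟩
    · rw [QuotientGroup.eq_iff_div_mem]
      simpa using hg
    · rw [mul_div_cancel₀ _ (pow_ne_zero p (ne_zero_of_val hω))]
      simp
  choose a x hx ha using hex
  let F : Eˣ ⧸ N → ResidueRing v ⧸ f.range := fun q =>
    QuotientAddGroup.mk (Ideal.Quotient.mk (maximalIdeal v) (a q))
  have hF : Function.Injective F := by
    intro q s hqs
    obtain ⟨z, hz⟩ := QuotientAddGroup.eq_iff_sub_mem.1 hqs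
    obtain ⟨z, rfl⟩ := Ideal.Quotient.mk_surjective z
    have hz1 : LevelGE v 1 (criticalMap p ω z - ((a q : E) - a s)) := by
      change (Ideal.Quotient.mk (maximalIdeal v)) z ^ p + c * Ideal.Quotient.mk _ z = _ at hz
      rw [← map_pow, ← map_mul, ← map_add, ← map_sub, Ideal.Quotient.eq] at hz
      exact hz
    obtain ⟨w, hw⟩ := h.exists_eq_mul_pow hlarge hω (a q).2 (a s).2 z.2 hz1
    rw [← ha, ← ha] at hw
    have hw0 : w ≠ 0 := by
      rintro rfl
      rw [zero_pow h.prime.ne_zero, mul_zero] at hw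
      exact (x q).ne_zero hw
    rw [← hx q, ← hx s, QuotientGroup.eq_iff_div_mem]
    convert hN (Units.mk0 w hw0)
    ext
    simp [hw]
  have hfin : Finite (Eˣ ⧸ N) := Finite.of_injective F hF
  refine ⟨Nat.card_pos.ne', ?_⟩
  exact (Nat.card_le_card_of_injective F hF).trans hf

end HasRootLevel

/-- A subgroup of index at most `p` which contains the `p`-th powers is maximal. -/
lemma eq_of_le_of_index_le {G : Type*} [CommGroup G] {p : ℕ} (hp : p.Prime) {N N' : Subgroup G}
    (hN : ∀ w : G, w ^ p ∈ N) (h0 : N.index ≠ 0) (hle : N.index ≤ p) (h : N ≤ N')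
    (hne : N' ≠ ⊤) : N' = N := by
  have hmul := Subgroup.relIndex_mul_index h
  have h0' : N'.index ≠ 0 := fun hz => h0 (by rw [← hmul, hz, mul_zero])
  obtain ⟨x, hx⟩ : ∃ x, x ∉ N' := by
    by_contra! hall
    exact hne (eq_top_iff.2 fun x _ => hall x)
  have : Fact p.Prime := ⟨hp⟩
  have hord : orderOf (QuotientGroup.mk x : G ⧸ N') = p := by
    refine orderOf_eq_prime ?_ ?_
    · rw [← QuotientGroup.mk_pow, QuotientGroup.eq_one_iff]
      exact h (hN x)
    · rwa [Ne, QuotientGroup.eq_one_iff]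
  have hdvd : p ∣ N'.index := hord ▸ orderOf_dvd_natCard _
  have hp' := Nat.le_of_dvd (Nat.pos_of_ne_zero h0') hdvd
  have hrel : N.relIndex N' = 1 := by
    have h1 : N.relIndex N' ≠ 0 := fun hz => h0 (by rw [← hmul, hz, zero_mul])
    have h2 := hp.pos
    have h3 : N.relIndex N' * p ≤ 1 * p := by
      calc _ ≤ N.relIndex N' * N'.index := Nat.mul_le_mul_left _ hp'
        _ ≤ 1 * p := by rw [hmul, one_mul]; exact hle
    have := Nat.le_of_mul_le_mul_right h3 h2
    omega
  exact le_antisymm (Subgroup.relIndex_eq_one.1 hrel) h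

end Index

section Representatives

variable {E : Type*} [Field E] {v : AddValuation E (WithTop ℤ)}

lemma LevelGE.pow_sub_one_sub {n : ℤ} (hn : 1 ≤ n) {g : E} (hg : LevelGE v n g) (m : ℕ) :
    LevelGE v (n + 1) ((1 + g) ^ m - 1 - m * g) := by
  induction m with
  | zero => simpa using LevelGE.zero _
  | succ m ih =>
    have : (1 + g) ^ (m + 1) - 1 - ((m + 1 : ℕ) : E) * g =
        (1 + g) * ((1 + g) ^ m - 1 - m * g) + m * (g * g) := by
      push_cast
      ring
    rw [this]
    exact ((LevelGE.one.add (hg.mono (by omega))).mul' ih (by omega)).add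
      ((LevelGE.natCast m).mul' (hg.mul hg) (by omega))

lemma LevelGE.prod_pow_sub_one_sub {ι : Type*} (s : Finset ι) {n : ℤ} (hn : 1 ≤ n) {g : ι → E}
    (hg : ∀ i, LevelGE v n (g i)) (m : ι → ℕ) :
    LevelGE v (n + 1) (∏ i ∈ s, (1 + g i) ^ m i - 1 - ∑ i ∈ s, m i * g i) := by
  induction s using Finset.induction_on with
  | empty => simpa using LevelGE.zero _
  | insert a s ha ih =>
    rw [Finset.prod_insert ha, Finset.sum_insert ha]
    set P := ∏ i ∈ s, (1 + g i) ^ m i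
    set S := ∑ i ∈ s, m i * g i
    have : (1 + g a) ^ m a * P - 1 - (m a * g a + S) =
        (1 + g a) ^ m a * (P - 1 - S) + ((1 + g a) ^ m a - 1 - m a * g a) +
          ((1 + g a) ^ m a - 1 - m a * g a + m a * g a) * S := by
      ring
    rw [this]
    have hS : LevelGE v n S :=
      LevelGE.sum fun i _ => (LevelGE.natCast _).mul' (hg i) (by omega)
    have h1 := (hg a).pow_sub_one_sub hn (m a)
    have h2 : LevelGE v n (m a * g a) := (LevelGE.natCast _).mul' (hg a) (by omega)
    refine LevelGE.add (LevelGE.add (LevelGE.mul' (m := 0) (n := n + 1) ?_ ih (by omega)) h1) ?_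
    · exact LevelGE.pow0 (LevelGE.one.add ((hg a).mono (by omega))) (m a)
    · exact ((h1.mono (by omega)).add h2).mul' hS (by omega)

/-- One-unit classes of level `n` are represented by products of the `1 + c_y π ^ n`. -/
lemma IsResidueBasis.exists_prod {p f : ℕ} (hp : 0 < p) (hv : LevelGE v 1 (p : E))
    {c : Fin f → E} (hc : IsResidueBasis p v c) {π : E} (hπ : v π = ((1 : ℤ) : WithTop ℤ))
    {n : ℕ} (hn : 1 ≤ n) {x : E} (hx : LevelGE v n (x - 1)) :
    ∃ m : Fin f → ℕ, LevelGE v (n + 1) (x - ∏ y, (1 + c y * π ^ n) ^ m y) := by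
  have hπn : v (π ^ n) = ((n : ℤ) : WithTop ℤ) := by simpa using val_pow hπ n
  have hn' : (1 : ℤ) ≤ n := by exact_mod_cast hn
  have hc0 : ∀ y, LevelGE v 0 (c y) := hc.1
  obtain ⟨a, ha⟩ := hc.2.2 ((x - 1) / π ^ n) (LevelGE.inv_mul hπn hx (by omega))
  change LevelGE v 1 _ at ha
  have hp' : (p : ℤ) ≠ 0 := by exact_mod_cast hp.ne'
  let m : Fin f → ℕ := fun y => (a y % p).toNat
  have hm : ∀ y, (a y : E) = m y + p * ((a y / p : ℤ) : E) := by
    intro y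
    have h1 : ((m y : ℕ) : ℤ) = a y % p := Int.toNat_of_nonneg (Int.emod_nonneg _ hp')
    have h2 : a y = m y + p * (a y / p) := by rw [h1]; exact (Int.emod_add_mul_ediv _ _).symm
    exact_mod_cast congrArg (Int.cast : ℤ → E) h2
  have h3 : LevelGE v 1 ((x - 1) / π ^ n - ∑ y, (m y : E) * c y) := by
    have : (x - 1) / π ^ n - ∑ y, (m y : E) * c y =
        ((x - 1) / π ^ n - ∑ y, (a y : E) * c y) + ∑ y, p * ((a y / p : ℤ) : E) * c y := by
      simp_rw [hm, add_mul, Finset.sum_add_distrib]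
      ring
    rw [this]
    exact ha.add (LevelGE.sum fun y _ =>
      (hv.mul' (LevelGE.intCast _) (k := 1) (by omega)).mul' (hc0 y) (by omega))
  refine ⟨m, ?_⟩
  have h4 := LevelGE.prod_pow_sub_one_sub Finset.univ hn'
    (fun y => (hc0 y).mul' (levelGE_of_eq hπn) (k := n) (by omega)) m
  have h5 : LevelGE v (n + 1) (π ^ n * ((x - 1) / π ^ n - ∑ y, (m y : E) * c y)) :=
    (levelGE_of_eq hπn).mul' h3 (by omega)
  convert h5.sub h4 using 1
  rw [mul_sub, mul_div_cancel₀ _ (ne_zero_of_val hπn), Finset.mul_sum]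
  have : ∑ y, (m y : E) * (c y * π ^ n) = ∑ y, π ^ n * ((m y : E) * c y) :=
    Finset.sum_congr rfl fun y _ => by ring
  rw [this]
  ring

/-- `p`-th powers are surjective on residues. -/
lemma exists_pow_residue {p : ℕ} (hp : p.Prime) (hv : LevelGE v 1 (p : E)) [Finite (Residues v)]
    {x : E} (hx : LevelGE v 0 x) : ∃ z, LevelGE v 0 z ∧ LevelGE v 1 (z ^ p - x) :=
  residue_surjective_of_injective (fun z => z ^ p) (fun _ h => h.pow0 p)
    (fun _ _ hx hy hxy => levelGE_pow_sub_pow hx hy hxy p)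
    (fun _ _ hx hy hxy => levelGE_sub_of_pow_sub hp hv hx hy hxy) x hx

/-- A subgroup containing `p`-th powers, a uniformizer and enough one-units meets every class modulo
the units of level `n`, for `n ≤ pr`. -/
lemma HasRootLevel.exists_mem_levelGE {p r : ℕ} (h : HasRootLevel v p r) [Finite (Residues v)]
    {N : Subgroup Eˣ} (hN : ∀ w : Eˣ, w ^ p ∈ N)
    (hunif : ∃ ϖ ∈ N, v (ϖ : E) = ((1 : ℤ) : WithTop ℤ))
    (hstep : ∀ n : ℕ, 1 ≤ n → n < p * r → n.Coprime p → ∀ x : Eˣ, LevelGE v n ((x : E) - 1) →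
      ∃ g ∈ N, LevelGE v (n + 1) ((x : E) / g - 1))
    {n : ℕ} (hn : 1 ≤ n) (hnr : n ≤ p * r) (x : Eˣ) :
    ∃ g ∈ N, LevelGE v n ((x : E) / g - 1) := by
  obtain ⟨ϖ, hϖN, hϖ⟩ := hunif
  have hp2 : (2 : ℤ) ≤ p := by exact_mod_cast h.prime.two_le
  induction n, hn using Nat.le_induction with
  | base =>
    obtain ⟨k, hk⟩ := exists_val (v := v) x.ne_zero
    have hu : v ((x : E) / ϖ ^ k) = ((0 : ℤ) : WithTop ℤ) := by
      rw [val_div hk (val_zpow hϖ k)]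
      simp
    obtain ⟨s, hs, hsu⟩ := exists_pow_residue h.prime h.levelGE_one (levelGE_of_eq hu)
    have hsp := val_eq_of_sub hu hsu
    have hs0 : s ≠ 0 := by
      rintro rfl
      rw [zero_pow h.prime.ne_zero] at hsp
      exact ne_zero_of_val hsp rfl
    refine ⟨ϖ ^ k * Units.mk0 s hs0 ^ p, N.mul_mem (N.zpow_mem hϖN k) (hN _), ?_⟩
    push_cast
    rw [Units.val_mk0, ← div_div]
    exact hsu.sub_comm.div_sub_one' hsp
  | succ n hn ih =>
    obtain ⟨g, hg, hx⟩ := ih (by omega)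
    suffices ∃ g' ∈ N, LevelGE v (n + 1) (((x / g : Eˣ) : E) / g' - 1) by
      obtain ⟨g', hg', hx'⟩ := this
      refine ⟨g * g', N.mul_mem hg hg', ?_⟩
      push_cast at hx' ⊢
      rwa [← div_div]
    have hx1 : LevelGE v n (((x / g : Eˣ) : E) - 1) := by simpa using hx
    by_cases hcop : n.Coprime p
    · exact hstep n hn (by omega) hcop (x / g) hx1
    · obtain ⟨q, rfl⟩ : p ∣ n := by
        by_contra hnd
        exact hcop ((Nat.Prime.coprime_iff_not_dvd h.prime).2 hnd).symm
      have hqr : q < r := lt_of_mul_lt_mul_left (by omega : p * q < p * r) (Nat.zero_le p)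
      have hq1 : 1 ≤ q := by
        by_contra hq
        simp [show q = 0 by omega] at hn
      have hqr' : (q : ℤ) < r := by exact_mod_cast hqr
      have hq1' : (1 : ℤ) ≤ q := by exact_mod_cast hq1
      have hϖq : v ((ϖ : E) ^ q) = ((q : ℤ) : WithTop ℤ) := by simpa using val_pow hϖ q
      have hϖq0 := ne_zero_of_val hϖq
      set X : E := ((x / g : Eˣ) : E)
      obtain ⟨s, hs, hsu⟩ := exists_pow_residue h.prime h.levelGE_one
        (LevelGE.inv_mul (val_pow hϖq p) hx1 (k := 0) (by push_cast; omega))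
      have hy : LevelGE v q (s * (ϖ : E) ^ q) := hs.mul' (levelGE_of_eq hϖq) (by omega)
      have h1 := (h.levelGE_pow_sub_sub (by omega) hy).mono (m := p * q + 1) (by nlinarith)
      have h2 := (levelGE_of_eq (val_pow hϖq p)).mul' hsu (k := p * q + 1) (by omega)
      rw [mul_sub, mul_div_cancel₀ _ (pow_ne_zero p hϖq0)] at h2
      have h3 : LevelGE v (p * q + 1) ((1 + s * (ϖ : E) ^ q) ^ p - X) := by
        convert h1.add h2 using 1
        ring
      have h4 : v (1 + s * (ϖ : E) ^ q) = ((0 : ℤ) : WithTop ℤ) :=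
        val_of_sub_one hq1' (by rwa [add_sub_cancel_left])
      refine ⟨Units.mk0 _ (ne_zero_of_val h4) ^ p, hN _, ?_⟩
      push_cast
      rw [Units.val_mk0]
      exact h3.sub_comm.div_sub_one' (by simpa using val_pow h4 p)

end Representatives

section EtaGroup

variable {E : Type*} [Field E] {v : AddValuation E (WithTop ℤ)}

lemma LevelGE.prod_sub_one {ι : Type*} {s : Finset ι} {g : ι → E} {n : ℤ} (hn : 0 ≤ n)
    (h : ∀ i ∈ s, LevelGE v n (g i - 1)) : LevelGE v n (∏ i ∈ s, g i - 1) := by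
  induction s using Finset.induction_on with
  | empty => simpa using LevelGE.zero n
  | insert a s ha ih =>
    rw [Finset.prod_insert ha]
    exact (h a (by simp)).mul_sub_one hn (ih fun i hi => h i (by simp [hi]))

lemma LevelGE.pow_sub_one {x : E} {n : ℤ} (hn : 0 ≤ n) (h : LevelGE v n (x - 1)) (k : ℕ) :
    LevelGE v n (x ^ k - 1) := by
  simpa using LevelGE.prod_sub_one (s := Finset.range k) (g := fun _ => x) hn fun _ _ => h

/-- The subgroup generated by the `p`-th powers, `π` and the elements `1 + c_y π ^ x` with
`x < t` prime to `p`. -/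
def etaGroup (p t : ℕ) (π : E) {f : ℕ} (c : Fin f → E) : Subgroup Eˣ :=
  Subgroup.closure {u : Eˣ | (∃ w : Eˣ, w ^ p = u) ∨ (u : E) = π ∨
    ∃ x : ℕ, (1 ≤ x ∧ x < t ∧ x.Coprime p) ∧ ∃ y, (u : E) = 1 + c y * π ^ x}

/-- The product of the generators `1 + c_y π ^ n` with multiplicities `m`. -/
def etaProd (π : E) {f : ℕ} (c : Fin f → E) (n : ℕ) (m : Fin f → ℕ) : E :=
  ∏ y, (1 + c y * π ^ n) ^ m y

/-- The indices from `n` up to `t` prime to `p`. -/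
def coprimeIco (p n t : ℕ) : Finset ℕ := (Finset.Ico n t).filter fun x => x.Coprime p

lemma etaProd_add (π : E) {f : ℕ} (c : Fin f → E) (n : ℕ) (m m' : Fin f → ℕ) :
    etaProd π c n (m + m') = etaProd π c n m * etaProd π c n m' := by
  simp [etaProd, pow_add, Finset.prod_mul_distrib]

lemma exists_of_mem_etaGroup {p t : ℕ} (hp : p.Prime) {π : E} {f : ℕ} {c : Fin f → E} {u : Eˣ}
    (hu : u ∈ etaGroup p t π c) :
    ∃ (w : E) (k : ℕ) (m : ℕ → Fin f → ℕ),
      (u : E) = w ^ p * π ^ k * ∏ n ∈ coprimeIco p 1 t, etaProd π c n (m n) := by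
  let Q : Eˣ → Prop := fun u => ∃ (w : E) (k : ℕ) (m : ℕ → Fin f → ℕ),
    (u : E) = w ^ p * π ^ k * ∏ n ∈ coprimeIco p 1 t, etaProd π c n (m n)
  have hpow (w : Eˣ) : Q (w ^ p) := ⟨w, 0, 0, by simp [etaProd]⟩
  have hmul (x y : Eˣ) : Q x → Q y → Q (x * y) := by
    rintro ⟨w, k, m, h⟩ ⟨w', k', m', h'⟩
    refine ⟨w * w', k + k', m + m', ?_⟩
    simp only [Pi.add_apply, etaProd_add, Finset.prod_mul_distrib]
    rw [Units.val_mul, h, h']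
    ring
  have hone : Q 1 := by simpa using hpow 1
  have hpows (x : Eˣ) (hx : Q x) (k : ℕ) : Q (x ^ k) := by
    induction k with
    | zero => simpa using hone
    | succ k ih =>
      rw [pow_succ]
      exact hmul _ _ ih hx
  change Q u
  refine Subgroup.closure_induction (p := fun u _ => Q u) ?_ hone
    (fun x y _ _ hx hy => hmul x y hx hy) ?_ hu
  · rintro x (⟨w, rfl⟩ | hx | ⟨n, ⟨h1, h2, h3⟩, y, hx⟩)
    · exact hpow w
    · exact ⟨1, 1, 0, by simp [etaProd, hx]⟩
    · refine ⟨1, 0, Pi.single n (Pi.single y 1), ?_⟩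
      rw [Finset.prod_eq_single n]
      · rw [etaProd, Finset.prod_eq_single y]
        · simp [hx]
        · intro z _ hz
          simp [hz]
        · simp
      · intro i _ hi
        simp [etaProd, hi]
      · simp [coprimeIco, h1, h2, h3]
  · intro x _ hx
    have : x⁻¹ = x⁻¹ ^ p * x ^ (p - 1) := by
      rw [← pow_sub_one_mul hp.ne_zero x⁻¹, mul_right_comm, ← mul_pow]
      simp
    rw [this]
    exact hmul _ _ (hpow _) (hpows x hx _)

namespace HasRootLevel

variable {p r f : ℕ} {π : E} {c : Fin f → E}

/-- A product of generators lying in the units of level `pr` is a `p`-th power. -/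
lemma exists_pow_eq_of_levelGE (h : HasRootLevel v p r) (hπ : v π = ((1 : ℤ) : WithTop ℤ))
    (hc : IsResidueBasis p v c) (m : ℕ → Fin f → ℕ) {n : ℕ} (hn : 1 ≤ n) (hnt : n ≤ p * r)
    {w : E} (hw : LevelGE v (p * r)
      (w ^ p * ∏ i ∈ coprimeIco p n (p * r), etaProd π c i (m i) - 1)) :
    ∃ z, w ^ p * ∏ i ∈ coprimeIco p n (p * r), etaProd π c i (m i) = z ^ p := by
  have hp2 : (2 : ℤ) ≤ p := by exact_mod_cast h.prime.two_le
  have hc0 : ∀ y, LevelGE v 0 (c y) := hc.1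
  have hη (i : ℕ) (y : Fin f) : LevelGE v i (c y * π ^ i) :=
    (hc0 y).mul' (levelGE_of_eq (val_pow hπ i)) (by simp)
  have hlev (i : ℕ) : LevelGE v i (etaProd π c i (m i) - 1) :=
    LevelGE.prod_sub_one (by omega) fun y _ =>
      LevelGE.pow_sub_one (by omega) (by simpa using hη i y) _
  induction hd : p * r - n generalizing n w with
  | zero =>
    refine ⟨w, ?_⟩
    simp [coprimeIco, show n = p * r by omega]
  | succ d ih =>
    have hlt : n < p * r := by omega
    have hn' : (1 : ℤ) ≤ n := by exact_mod_cast hn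
    have hlt' : (n : ℤ) < p * r := by exact_mod_cast hlt
    by_cases hcop : n.Coprime p
    · have hset : coprimeIco p n (p * r) = insert n (coprimeIco p (n + 1) (p * r)) := by
        ext i
        simp only [coprimeIco, Finset.mem_filter, Finset.mem_Ico, Finset.mem_insert]
        constructor
        · rintro ⟨⟨h1, h2⟩, h3⟩
          by_cases hi : i = n
          · exact Or.inl hi
          · exact Or.inr ⟨⟨by omega, h2⟩, h3⟩
        · rintro (rfl | ⟨⟨h1, h2⟩, h3⟩)
          · exact ⟨⟨le_rfl, hlt⟩, hcop⟩
          · exact ⟨⟨by omega, h2⟩, h3⟩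
      have hnot : n ∉ coprimeIco p (n + 1) (p * r) := by simp [coprimeIco]
      rw [hset, Finset.prod_insert hnot] at hw ⊢
      set A := etaProd π c n (m n) with hA
      set B := ∏ i ∈ coprimeIco p (n + 1) (p * r), etaProd π c i (m i)
      have hB : LevelGE v (n + 1) (B - 1) := LevelGE.prod_sub_one (by omega) fun i hi =>
        (hlev i).mono (by
          have := (Finset.mem_Ico.1 (Finset.mem_filter.1 hi).1).1
          exact_mod_cast this)
      have hB0 := ne_zero_of_val (val_of_sub_one (by omega) hB)
      have hA1 : LevelGE v n (A - 1) := hlev n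
      have hA0 := ne_zero_of_val (val_of_sub_one hn' hA1)
      have hwA : LevelGE v (n + 1) (w ^ p * A - 1) := by
        convert (hw.mono (m := n + 1) (by omega)).div_sub_one (by omega) hB using 1
        field_simp
      have hwp : LevelGE v n (w ^ p - 1) := by
        convert (hwA.mono (m := n) (by omega)).div_sub_one (by omega) hA1 using 1
        field_simp
      have hw0 : LevelGE v 0 w := by
        have hwv := val_of_sub_one hn' hwp
        have hw00 : w ≠ 0 := by
          rintro rfl
          rw [zero_pow h.prime.ne_zero] at hwv
          exact ne_zero_of_val hwv rfl
        obtain ⟨k, hk⟩ := exists_val (v := v) hw00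
        rw [val_pow hk, WithTop.coe_inj] at hwv
        rw [levelGE_iff hk]
        rcases mul_eq_zero.1 hwv with h' | h' <;> omega
      have hw1 : LevelGE v 1 (w - 1) := by
        refine levelGE_sub_of_pow_sub h.prime h.levelGE_one hw0 LevelGE.one ?_
        rw [one_pow]
        exact hwp.mono hn'
      have hwp' : LevelGE v (n + 1) (w ^ p - 1) := by
        rcases h.val_pow_sub_one_or hw1 with ⟨k, -, -, hk⟩ | hr
        · rw [add_sub_cancel] at hk
          rw [levelGE_iff hk] at hwp ⊢
          rcases hwp.lt_or_eq with hlt | heq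
          · omega
          · exfalso
            have hdvd : (p : ℤ) ∣ n := ⟨k, heq⟩
            exact (Nat.Prime.coprime_iff_not_dvd h.prime).1 hcop.symm (by exact_mod_cast hdvd)
        · have := h.levelGE_pow_sub_one hr
          rw [add_sub_cancel] at this
          exact this.mono (by omega)
      have hw0' := ne_zero_of_val (val_of_sub_one (by omega) hwp')
      have hA2 : LevelGE v (n + 1) (A - 1) := by
        convert hwA.div_sub_one (by omega) hwp' using 1
        field_simp
      have hsum := hA2.sub (LevelGE.prod_pow_sub_one_sub Finset.univ hn' (hη n) (m n))
      have hπn := val_pow hπ n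
      have hsum' : LevelGE v 1 (∑ y, ((m n y : ℤ) : E) * c y) := by
        have : ∑ y, ((m n y : ℤ) : E) * c y = (∑ y, (m n y : E) * (c y * π ^ n)) / π ^ n := by
          rw [eq_div_iff (ne_zero_of_val hπn), Finset.sum_mul]
          exact Finset.sum_congr rfl fun y _ => by push_cast; ring
        rw [this]
        refine LevelGE.inv_mul hπn (n := n + 1) ?_ (by simp)
        convert hsum using 1
        simp [hA, etaProd]
      have hdvd := hc.2.1 (fun y => m n y) hsum'
      have hApow : A = (∏ y, (1 + c y * π ^ n) ^ (m n y / p)) ^ p := by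
        rw [hA, etaProd, ← Finset.prod_pow]
        refine Finset.prod_congr rfl fun y _ => ?_
        rw [← pow_mul, Nat.div_mul_cancel (by exact_mod_cast hdvd y)]
      set A' := ∏ y, (1 + c y * π ^ n) ^ (m n y / p)
      have heq : w ^ p * (A * B) = (w * A') ^ p * B := by
        rw [hApow]
        ring
      rw [heq] at hw ⊢
      exact ih (by omega) (by omega) hw (by omega)
    · have hset : coprimeIco p n (p * r) = coprimeIco p (n + 1) (p * r) := by
        ext i
        simp only [coprimeIco, Finset.mem_filter, Finset.mem_Ico]
        refine and_congr_left fun hi => ⟨fun h1 => ⟨?_, h1.2⟩, fun h1 => ⟨by omega, h1.2⟩⟩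
        rcases h1.1.lt_or_eq with h2 | h2
        · exact h2
        · exact absurd (h2 ▸ hi) hcop
      rw [hset] at hw ⊢
      exact ih (by omega) (by omega) hw (by omega)

lemma etaGroup_ne_top (h : HasRootLevel v p r) [Finite (Residues v)]
    (hπ : v π = ((1 : ℤ) : WithTop ℤ)) (hc : IsResidueBasis p v c)
    (hζ : ∃ ζ : E, IsPrimitiveRoot ζ p) : etaGroup p (p * r) π c ≠ ⊤ := by
  intro htop
  obtain ⟨ζ, hζ⟩ := hζ
  have hω : v (π ^ r) = ((r : ℤ) : WithTop ℤ) := by simpa using val_pow hπ r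
  have hp2 : (2 : ℤ) ≤ p := by exact_mod_cast h.prime.two_le
  have hr1 : (1 : ℤ) ≤ r := by exact_mod_cast h.pos
  obtain ⟨a, ha, hcon⟩ := h.exists_not_criticalMap hω hζ
  obtain ⟨h1, h2⟩ := h.val_one_add hω ha
  have hmem : Units.mk0 _ (ne_zero_of_val h2) ∈ etaGroup p (p * r) π c := htop ▸ Subgroup.mem_top _
  obtain ⟨w, k, m, heq⟩ := exists_of_mem_etaGroup h.prime hmem
  rw [Units.val_mk0] at heq
  have hc0 : ∀ y, LevelGE v 0 (c y) := hc.1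
  have hH : v (∏ n ∈ coprimeIco p 1 (p * r), etaProd π c n (m n)) = ((0 : ℤ) : WithTop ℤ) := by
    refine val_of_sub_one le_rfl (LevelGE.prod_sub_one (by omega) fun n hn =>
      LevelGE.prod_sub_one (by omega) fun y _ => LevelGE.pow_sub_one (by omega) ?_ _)
    rw [add_sub_cancel_left]
    refine (hc0 y).mul' (levelGE_of_eq (val_pow hπ n)) ?_
    have := (Finset.mem_Ico.1 (Finset.mem_filter.1 hn).1).1
    simp only [zero_add, mul_one]
    exact_mod_cast this
  have hw0 : w ≠ 0 := by
    rintro rfl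
    rw [zero_pow h.prime.ne_zero, zero_mul, zero_mul] at heq
    exact ne_zero_of_val h2 heq
  obtain ⟨s, hs⟩ := exists_val (v := v) hw0
  rw [heq, val_mul (val_mul (val_pow hs p) (val_pow hπ k)) hH, WithTop.coe_inj] at h2
  obtain ⟨q, rfl⟩ : p ∣ k := by
    have : (p : ℤ) ∣ k := ⟨-s, by linarith⟩
    exact_mod_cast this
  rw [pow_mul', ← mul_pow] at heq
  rw [heq] at h1
  obtain ⟨z, hz⟩ := h.exists_pow_eq_of_levelGE hπ hc m le_rfl
    (by have := Nat.mul_pos h.prime.pos h.pos; omega) h1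
  rw [← heq] at hz
  obtain ⟨x, hx, hx'⟩ := h.exists_criticalMap_of_pow hω ha hz.symm
  exact hcon x hx hx'

/-- Every class modulo the units of level `n ≤ pr` meets `etaGroup`. -/
lemma exists_mem_etaGroup (h : HasRootLevel v p r) [Finite (Residues v)]
    (hπ : v π = ((1 : ℤ) : WithTop ℤ)) (hc : IsResidueBasis p v c)
    {n : ℕ} (hn : 1 ≤ n) (hnr : n ≤ p * r) (x : Eˣ) :
    ∃ g ∈ etaGroup p (p * r) π c, LevelGE v n ((x : E) / g - 1) := by
  have hc0 : ∀ y, LevelGE v 0 (c y) := hc.1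
  have hpow (w : Eˣ) : w ^ p ∈ etaGroup p (p * r) π c :=
    Subgroup.subset_closure (Or.inl ⟨w, rfl⟩)
  refine h.exists_mem_levelGE hpow
    ⟨Units.mk0 π (ne_zero_of_val hπ), Subgroup.subset_closure (Or.inr (Or.inl rfl)), hπ⟩ ?_
    hn hnr x
  intro n hn hnt hcop x hx
  have hn' : (1 : ℤ) ≤ n := by exact_mod_cast hn
  obtain ⟨m, hm⟩ := hc.exists_prod h.prime.pos h.levelGE_one hπ hn hx
  have hη (y : Fin f) : v (1 + c y * π ^ n) = ((0 : ℤ) : WithTop ℤ) := by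
    refine val_of_sub_one hn' ?_
    rw [add_sub_cancel_left]
    exact (hc0 y).mul' (levelGE_of_eq (val_pow hπ n)) (by simp)
  refine ⟨∏ y, Units.mk0 _ (ne_zero_of_val (hη y)) ^ m y, ?_, ?_⟩
  · refine Subgroup.prod_mem _ fun y _ => Subgroup.pow_mem _ (Subgroup.subset_closure ?_) _
    exact Or.inr (Or.inr ⟨n, ⟨hn, hnt, hcop⟩, y, rfl⟩)
  · push_cast
    refine hm.div_sub_one' ?_
    have hx0 := val_of_sub_one hn' hx
    exact val_eq_of_sub hx0 (hm.sub_comm.mono (by omega))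

/-- The only proper overgroup of `etaGroup` is itself. -/
lemma eq_etaGroup (h : HasRootLevel v p r) [Finite (Residues v)]
    (hlarge : ∃ m : ℕ, ∀ x : E, LevelGE v m (x - 1) → ∃ w : E, w ^ p = x)
    (hπ : v π = ((1 : ℤ) : WithTop ℤ)) (hc : IsResidueBasis p v c) {N : Subgroup Eˣ}
    (hN : etaGroup p (p * r) π c ≤ N) (hne : N ≠ ⊤) : N = etaGroup p (p * r) π c := by
  have hpow (w : Eˣ) : w ^ p ∈ etaGroup p (p * r) π c :=
    Subgroup.subset_closure (Or.inl ⟨w, rfl⟩)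
  have hω : v (π ^ r) = ((r : ℤ) : WithTop ℤ) := by simpa using val_pow hπ r
  obtain ⟨h0, hle⟩ := h.index_le hlarge hω hpow fun x => by
    simpa using h.exists_mem_etaGroup hπ hc (Nat.mul_pos h.prime.pos h.pos) le_rfl x
  exact eq_of_le_of_index_le h.prime hpow h0 hle hN hne

end HasRootLevel

end EtaGroup

section DegreePrime

variable {A M : Type*} [Field A] [Field M] [Algebra A M] [FiniteDimensional A M]

lemma pow_finrank_mem_normGroup (w : Aˣ) : w ^ Module.finrank A M ∈ normGroup A M :=
  mem_normGroup_iff.2 ⟨algebraMap A M w, by rw [Algebra.norm_algebraMap, Units.val_pow_eq_pow_val]⟩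

variable [IsGalois A M]

/-- An abelian extension of a `p`-adic field whose norm group is a maximal subgroup containing the
`p`-th powers has degree `p`. -/
theorem finrank_eq_of_normGroup_maximal {p : ℕ} [Fact p.Prime] [Algebra ℚ_[p] A]
    [FiniteDimensional ℚ_[p] A] {vA : AddValuation A (WithTop ℤ)}
    {vM : AddValuation M (WithTop ℤ)} {eA e : ℕ} (hvA : IsPadicValuation p vA eA)
    (hab : ∀ σ τ : M ≃ₐ[A] M, σ * τ = τ * σ) (hext : Extends vA vM e) (hinv : GalInvariant A vM)
    (hpow : ∀ w : Aˣ, w ^ p ∈ normGroup A M) (hne : normGroup A M ≠ ⊤)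
    (hmax : ∀ N, normGroup A M ≤ N → N ≠ ⊤ → N = normGroup A M) :
    Module.finrank A M = p := by
  have hp : p.Prime := Fact.out
  have hfinA := hvA.finite_residues
  have hchar : CharZero A := charZero_of_injective_algebraMap (algebraMap ℚ_[p] A).injective
  have hprime : ∀ {ℓ : ℕ}, ℓ.Prime → ℓ ∣ Module.finrank A M → ℓ = p := by
    intro ℓ hℓ hdvd
    by_contra hℓp
    obtain ⟨E, hE, -, hEne⟩ := exists_intermediateField_normGroup_ne_top hab hℓ hdvd hvA.1 hext hinv
      (by exact_mod_cast hℓ.ne_zero)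
    refine hEne (eq_top_iff.2 fun w _ => ?_)
    have h1 : w ^ ℓ ∈ normGroup A E := hE ▸ pow_finrank_mem_normGroup w
    have h2 : w ^ p ∈ normGroup A E := normGroup_le E (hpow w)
    have h3 := Nat.gcd_eq_gcd_ab ℓ p
    rw [(Nat.coprime_primes hℓ hp).2 hℓp] at h3
    have h4 : w = (w ^ ℓ) ^ ℓ.gcdA p * (w ^ p) ^ ℓ.gcdB p := by
      rw [← zpow_natCast, ← zpow_natCast, ← zpow_mul, ← zpow_mul, ← zpow_add, ← h3]
      simp
    rw [h4]
    exact Subgroup.mul_mem _ (Subgroup.zpow_mem _ h1 _) (Subgroup.zpow_mem _ h2 _)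
  have hpos : 0 < Module.finrank A M := Module.finrank_pos
  have hpow' := Nat.eq_prime_pow_of_unique_prime_dvd hpos.ne' hprime
  have hdvd : p ∣ Module.finrank A M := by
    by_contra hnd
    have h1 : Module.finrank A M = 1 := by
      by_contra h1
      obtain ⟨q, hq, hqd⟩ := Nat.exists_prime_and_dvd h1
      exact hnd (hprime hq hqd ▸ hqd)
    refine hne (eq_top_iff.2 fun w _ => ?_)
    simpa [h1] using pow_finrank_mem_normGroup (M := M) w
  obtain ⟨E, hE, hGalE, hEne⟩ := exists_intermediateField_normGroup_ne_top hab hp hdvd hvA.1 hext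
    hinv (by exact_mod_cast hp.ne_zero)
  have hEN := hmax _ (normGroup_le E) hEne
  have hmul := Module.finrank_mul_finrank A E M
  obtain ⟨k, -, hk⟩ := (Nat.dvd_prime_pow hp).1
    (hpow' ▸ Dvd.intro_left _ hmul : Module.finrank E M ∣ _)
  rcases Nat.eq_zero_or_pos k with rfl | hk0
  · rw [← hmul, hk, hE, pow_zero, mul_one]
  exfalso
  refine normGroup_ne_of_chain (A := A) (E := E) (M := M) hp hE hk ?_ hEN.symm
  obtain ⟨vE, e₁, e₂, hvE, h1, h2⟩ := exists_intermediate_valuation (E := E) hvA.1 hext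
  have hfinE := h1.finite_residues p hvA hvE
  have hab' (σ τ : M ≃ₐ[E] M) : σ * τ = τ * σ := by
    ext x
    exact DFunLike.congr_fun (hab (σ.restrictScalars A) (τ.restrictScalars A)) x
  obtain ⟨F, -, -, hF⟩ := exists_intermediateField_normGroup_ne_top hab' hp
    (hk ▸ dvd_pow_self p hk0.ne') hvE h2 (hinv.top E) (by exact_mod_cast hp.ne_zero)
  exact fun htop => hF (top_le_iff.1 (htop ▸ normGroup_le F))

end DegreePrime

section UpperNumbering

namespace IsWild

variable {A M : Type*} [Field A] [Field M] [Algebra A M] [FiniteDimensional A M]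
  {vA : AddValuation A (WithTop ℤ)} {vM : AddValuation M (WithTop ℤ)} {ℓ : ℕ} {ϖ : M}
  {σ : M ≃ₐ[A] M} {b : ℤ}

lemma lowerRG_eq_top (h : IsWild vA vM ℓ ϖ σ b) {i : ℤ} (hi : i ≤ b) :
    lowerRG vM h.inv i = ⊤ := by
  have hσ : σ ∈ lowerRG vM h.inv i := by
    intro x hx
    obtain ⟨a, -, ha⟩ := exists_residue h.prime.pos h.ext h.unif h.deg (x := x) hx
    have h1 := h.levelGE_sub 1 _ ha
    rw [map_sub, AlgEquiv.commutes, sub_sub_sub_cancel_right] at h1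
    exact h1.mono (by omega)
  exact eq_top_iff.2 fun τ _ => (Subgroup.zpowers_le.2 hσ) (h.gen τ)

variable [IsGalois A M]

lemma lowerRG_eq_bot (h : IsWild vA vM ℓ ϖ σ b) {i : ℤ} (hi : b < i) :
    lowerRG vM h.inv i = ⊥ := by
  rw [eq_bot_iff]
  intro τ hτ
  by_contra hτ1
  obtain ⟨k, rfl⟩ := mem_zpowers_of_finrank_prime h.prime h.deg hτ1 σ
  have h1 : LevelGE vM (i + 1) ((τ ^ k) ϖ - ϖ) :=
    Subgroup.zpow_mem _ hτ k ϖ (by rw [h.unif]; exact_mod_cast zero_le_one)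
  have h2 := LevelGE.inv_mul h.unif h1 (k := i) (by omega)
  rw [sub_div, div_self (ne_zero_of_val h.unif), levelGE_iff h.break_eq] at h2
  omega

lemma card_lowerRG (h : IsWild vA vM ℓ ϖ σ b) (i : ℤ) :
    (Nat.card (lowerRG vM h.inv i) : ℚ) = 1 + if i ≤ b then (ℓ - 1 : ℚ) else 0 := by
  split_ifs with hi
  · rw [h.lowerRG_eq_top hi, Subgroup.card_top, IsGalois.card_aut_eq_finrank, h.deg]
    ring
  · rw [h.lowerRG_eq_bot (not_le.1 hi), Subgroup.card_bot]
    simp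

lemma herbrandPhi_of_le (h : IsWild vA vM ℓ ϖ σ b) {n : ℤ} (hn : n ≤ b) :
    herbrandPhi vM h.inv n = n := by
  have hb := h.pos
  have hℓ : (ℓ : ℚ) ≠ 0 := by exact_mod_cast h.prime.ne_zero
  unfold herbrandPhi
  split_ifs with h0
  · rfl
  · have hsum : ∑ i ∈ Finset.Icc 1 n, (Nat.card (lowerRG vM h.inv i) : ℚ) =
        ∑ i ∈ Finset.Icc 1 n, (ℓ : ℚ) := by
      refine Finset.sum_congr rfl fun i hi => ?_
      rw [h.card_lowerRG, if_pos ((Finset.mem_Icc.1 hi).2.trans hn)]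
      ring
    have hcast : ((n.toNat : ℕ) : ℚ) = n := by
      exact_mod_cast congrArg (Int.cast : ℤ → ℚ) (Int.toNat_of_nonneg (show 0 ≤ n by omega))
    rw [hsum, h.card_lowerRG, if_pos (by omega), Finset.sum_const, Int.card_Icc]
    simp only [add_sub_cancel_right, nsmul_eq_mul, add_sub_cancel]
    rw [mul_div_cancel_right₀ _ hℓ, hcast]

lemma herbrandPhi_of_lt (h : IsWild vA vM ℓ ϖ σ b) {n : ℤ} (hn : b < n) :
    herbrandPhi vM h.inv n = b + (n - b) / ℓ := by
  have hb := h.pos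
  have hℓ : (ℓ : ℚ) ≠ 0 := by exact_mod_cast h.prime.ne_zero
  have hfilter : (Finset.Icc 1 n).filter (fun i => i ≤ b) = Finset.Icc 1 b := by
    ext i
    simp only [Finset.mem_filter, Finset.mem_Icc]
    omega
  have hcast (m : ℤ) (hm : 0 ≤ m) : ((m.toNat : ℕ) : ℚ) = m := by
    exact_mod_cast congrArg (Int.cast : ℤ → ℚ) (Int.toNat_of_nonneg hm)
  unfold herbrandPhi
  rw [if_neg (by omega)]
  simp_rw [h.card_lowerRG]
  rw [Finset.sum_add_distrib, ← Finset.sum_filter, hfilter, Finset.sum_const, Finset.sum_const,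
    Int.card_Icc, Int.card_Icc, if_pos (by omega)]
  simp only [add_sub_cancel_right, nsmul_eq_mul, add_sub_cancel]
  rw [hcast n (by omega), hcast b (by omega)]
  field_simp
  ring

lemma upperRG_of_le (h : IsWild vA vM ℓ ϖ σ b) {u : ℤ} (hu : u ≤ b) :
    upperRG vM h.inv u = ⊤ := by
  have hset : {n : ℤ | (u : ℚ) ≤ herbrandPhi vM h.inv n} = Set.Ici u := by
    ext n
    simp only [Set.mem_ofPred_eq, Set.mem_Ici]
    by_cases hn : n ≤ b
    · rw [h.herbrandPhi_of_le hn]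
      exact_mod_cast Iff.rfl
    · push Not at hn
      rw [h.herbrandPhi_of_lt hn]
      have h1 : (u : ℚ) ≤ b := by exact_mod_cast hu
      have h2 : (b : ℚ) < n := by exact_mod_cast hn
      have h3 : (0 : ℚ) ≤ (n - b) / ℓ := div_nonneg (by linarith) (Nat.cast_nonneg _)
      exact iff_of_true (by linarith) (by omega)
  rw [upperRG, hset, csInf_Ici]
  exact h.lowerRG_eq_top hu

lemma upperRG_of_lt (h : IsWild vA vM ℓ ϖ σ b) {u : ℤ} (hu : b < u) :
    upperRG vM h.inv u = ⊥ := by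
  have hsub : ∀ n ∈ {n : ℤ | (u : ℚ) ≤ herbrandPhi vM h.inv n}, b < n := by
    intro n hn
    by_contra! hnb
    rw [Set.mem_ofPred_eq, h.herbrandPhi_of_le hnb] at hn
    have : u ≤ n := by exact_mod_cast hn
    omega
  have hℓ : (ℓ : ℚ) ≠ 0 := by exact_mod_cast h.prime.ne_zero
  have hℓ1 : (1 : ℤ) ≤ ℓ := by exact_mod_cast h.prime.one_le
  have hne : {n : ℤ | (u : ℚ) ≤ herbrandPhi vM h.inv n}.Nonempty := by
    refine ⟨b + ℓ * (u - b), ?_⟩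
    rw [Set.mem_ofPred_eq, h.herbrandPhi_of_lt (by nlinarith)]
    push_cast
    rw [add_sub_cancel_left, mul_div_cancel_left₀ _ hℓ]
    linarith
  exact h.lowerRG_eq_bot (hsub _ (Int.csInf_mem hne ⟨b, fun n hn => (hsub n hn).le⟩))

/-- The unique upper ramification jump of a wildly ramified extension of prime degree. -/
theorem isUpperJump_iff (h : IsWild vA vM ℓ ϖ σ b) (s : ℤ) :
    IsUpperJump vM h.inv s ↔ s = b := by
  constructor
  · intro hs
    rcases lt_trichotomy s b with hlt | heq | hgt
    · exact absurd ((h.upperRG_of_le le_rfl).trans (h.upperRG_of_le hlt.le).symm) (hs b hlt)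
    · exact heq
    · exact absurd ((h.upperRG_of_lt (hgt.trans (lt_add_one s))).trans (h.upperRG_of_lt hgt).symm)
        (hs _ (lt_add_one s))
  · rintro rfl u hu
    rw [h.upperRG_of_lt hu, h.upperRG_of_le le_rfl]
    intro heq
    have hcard := congrArg (fun H : Subgroup (M ≃ₐ[A] M) => Nat.card H) heq
    simp only [Subgroup.card_bot, Subgroup.card_top, IsGalois.card_aut_eq_finrank, h.deg] at hcard
    exact h.prime.one_lt.ne hcard

end IsWild

end UpperNumbering

section Final

variable {A M : Type*} [Field A] [Field M] [Algebra A M] [FiniteDimensional A M] [IsGalois A M]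
  {vA : AddValuation A (WithTop ℤ)} {vM : AddValuation M (WithTop ℤ)}

/-- The break of a wild extension of degree `p` with norm group `etaGroup p (p * r) π c` is
`p * r`. -/
lemma IsWild.break_eq_of_normGroup {p r f : ℕ} {ϖ : M} {σ : M ≃ₐ[A] M} {b : ℤ}
    (h : IsWild vA vM p ϖ σ b) (hr : HasRootLevel vA p r) [Finite (Residues vA)] {π : A}
    {c : Fin f → A} (hπ : vA π = ((1 : ℤ) : WithTop ℤ)) (hc : IsResidueBasis p vA c)
    (hnorm : etaGroup p (p * r) π c ≤ normGroup A M) : b = ((p * r : ℕ) : ℤ) := by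
  have hp2 : (2 : ℤ) ≤ p := by exact_mod_cast h.prime.two_le
  have hb := h.pos
  push_cast
  refine le_antisymm ?_ ?_
  · have h1 := h.ext.val_map hr.val_prime
    rw [map_natCast] at h1
    nlinarith [h.break_le_val h1]
  · by_contra! hlt
    obtain ⟨z, hz, hcon⟩ := h.exists_not_norm
    have hz0 := val_of_sub_one hb hz
    obtain ⟨n, rfl⟩ := Int.eq_ofNat_of_zero_le (show 0 ≤ b by omega)
    obtain ⟨g, hg, hzg⟩ := hr.exists_mem_etaGroup hπ hc (n := n + 1) (by omega)
      (by exact_mod_cast hlt) (Units.mk0 z (ne_zero_of_val hz0))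
    obtain ⟨w, hw⟩ := mem_normGroup_iff.1 (hnorm hg)
    refine hcon w ?_
    rw [Units.val_mk0] at hzg
    push_cast at hzg
    have hg0 : vA (g : A) = ((0 : ℤ) : WithTop ℤ) := by
      have := val_div hz0 (val_of_sub_one (by omega) hzg)
      rwa [div_div_cancel₀ (ne_zero_of_val hz0), sub_zero] at this
    rw [hw]
    exact (LevelGE.sub_of_div hg0 hzg).sub_comm

end Final

/-- Lemma 10. If `ζ_p ∈ K` and `t' = p·e_K/(p-1)`, any finite abelian
extension `L/K` whose norm group is `N_{t'} = ⟨K^{×p}, π, {η_{(x,y)} : x ∈ I}⟩` is cyclic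
of degree `p` with unique upper ramification jump equal to `t'`. -/
theorem statement_5
    (p : ℕ) [Fact p.Prime]
    (K : Type*) [Field K] [Algebra ℚ_[p] K] [FiniteDimensional ℚ_[p] K]
    (vK : AddValuation K (WithTop ℤ)) (eK fK : ℕ)
    (hvK : IsPadicValuation p vK eK)
    (hfK : eK * fK = Module.finrank ℚ_[p] K)
    (hζ : ∃ ζ : K, IsPrimitiveRoot ζ p)
    (t' : ℕ) (ht' : (p - 1) * t' = p * eK)
    (π : K) (hπ : vK π = ((1 : ℤ) : WithTop ℤ))
    (c : Fin fK → K) (hc : IsResidueBasis p vK c)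
    (L : Type*) [Field L] [Algebra K L] [FiniteDimensional K L] [IsGalois K L]
    (hab : ∀ σ τ : L ≃ₐ[K] L, σ * τ = τ * σ)
    (hnorm : normGroup K L =
      Subgroup.closure {u : Kˣ | (∃ w : Kˣ, w ^ p = u) ∨ (u : K) = π ∨
        (∃ x : ℕ, (1 ≤ x ∧ (p - 1) * x < p * eK ∧ Nat.Coprime x p) ∧
          ∃ y : Fin fK, (u : K) = 1 + c y * π ^ x)})
    (vL : AddValuation L (WithTop ℤ)) (eL : ℕ)
    (hvL : IsNormalized vL) (hext : Extends vK vL eL) (hGal : GalInvariant K vL) :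
    Module.finrank K L = p ∧
    IsCyclic (L ≃ₐ[K] L) ∧
    (∀ s : ℤ, IsUpperJump vL hGal s ↔ s = (t' : ℤ)) := by
  have hp : p.Prime := Fact.out
  obtain ⟨r, rfl⟩ : p ∣ t' := by
    have hcop : p.Coprime (p - 1) :=
      (Nat.coprime_self_sub_right hp.one_le).2 (Nat.coprime_one_right p)
    exact hcop.dvd_of_dvd_mul_left ⟨eK, ht'⟩
  have heK : (p - 1) * r = eK :=
    Nat.eq_of_mul_eq_mul_left hp.pos (by rw [← ht']; ring)
  have hr : HasRootLevel vK p r := by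
    refine ⟨hp, Nat.pos_of_ne_zero ?_, ?_⟩
    · rintro rfl
      have := hvK.2.1
      omega
    · rw [hvK.val_natCast_self, ← heK, Nat.cast_mul, Nat.cast_sub hp.one_le, Nat.cast_one]
  have hfin := hvK.finite_residues
  have hlarge := hvK.exists_pow_eq
  have heta : normGroup K L = etaGroup p (p * r) π c := by
    rw [hnorm, etaGroup]
    have hlt (x : ℕ) : (p - 1) * x < p * eK ↔ x < p * r := by
      rw [← ht']
      exact Nat.mul_lt_mul_left (Nat.sub_pos_of_lt hp.one_lt)
    simp_rw [hlt]
  have hdeg : Module.finrank K L = p := by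
    refine finrank_eq_of_normGroup_maximal hvK hab hext hGal (fun w => ?_) ?_ fun N hN hNe => ?_
    · rw [heta]
      exact Subgroup.subset_closure (Or.inl ⟨w, rfl⟩)
    · rw [heta]
      exact hr.etaGroup_ne_top hπ hc hζ
    · rw [heta] at hN ⊢
      exact hr.eq_etaGroup hlarge hπ hc hN hNe
  refine ⟨hdeg, isCyclic_of_prime_card ((IsGalois.card_aut_eq_finrank K L).trans hdeg), ?_⟩
  obtain ⟨ϖ, hϖ⟩ := hvL 1
  obtain ⟨σ, hσ⟩ := exists_aut_ne_one hp hdeg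
  have heL : eL = p := by
    have hmem : Units.mk0 π (ne_zero_of_val hπ) ∈ normGroup K L := by
      rw [heta]
      exact Subgroup.subset_closure (Or.inr (Or.inl rfl))
    obtain ⟨w, hw⟩ := mem_normGroup_iff.1 hmem
    rw [Units.val_mk0] at hw
    have hw0 : w ≠ 0 := by
      rw [← Algebra.norm_ne_zero_iff (R := K), hw]
      exact ne_zero_of_val hπ
    obtain ⟨n, hn⟩ := exists_val (v := vL) hw0
    obtain ⟨m, hm, heq⟩ := exists_val_norm hext hGal hn
    rw [hw, hπ, WithTop.coe_inj] at hm
    rw [← hm, hdeg, mul_one] at heq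
    have hdvd : p ∣ eL := by
      have : (p : ℤ) ∣ eL := ⟨n, heq⟩
      exact_mod_cast this
    rcases ramification_eq_one_or hp hdeg hvL hext hGal with h1 | h1
    · rw [h1] at hdvd
      exact absurd (Nat.dvd_one.1 hdvd) hp.ne_one
    · exact h1
  subst heL
  have hp0 : ((eL : ℕ) : L) ≠ 0 := by
    rw [← map_natCast (algebraMap K L), Ne, map_eq_zero]
    exact hr.ne_zero
  obtain ⟨b, hb⟩ := exists_isWild hp hext hGal hϖ hdeg hσ hp0 hr.levelGE_one
  intro s
  rw [hb.isUpperJump_iff, hb.break_eq_of_normGroup hr hπ hc heta.ge]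
end PaperRam
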